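/- arXiv:1104.4692 — 4 statements merged into one kernel-verified Lean document; each statement's English description precedes it below -/
import Mathlib

section
/- Let d ≥ 1 and let X ⊆ Ω(d) be a complex spherical 𝒯-design for a lower set 𝒯. If 𝒰 is a lower set with 𝒰*𝒰 ⊆ 𝒯, then |X| ≥ Σ_{(k,l)∈𝒰} m_{k,l}. -/
open Finset

/-- The Hermitian inner product `x^* y = ∑ i, conj (x i) * y i` on `ℂ^d`. -/
noncomputable def cInner {d : ℕ} (x y : Fin d → ℂ) : ℂ :=
  ∑ i, (starRingEnd ℂ) (x i) * y i

/-- A lower set in `ℕ × ℕ` with respect to the product order. -/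
def IsLowerSet' (T : Finset (ℕ × ℕ)) : Prop :=
  ∀ kl ∈ T, ∀ mn : ℕ × ℕ, mn.1 ≤ kl.1 → mn.2 ≤ kl.2 → mn ∈ T

/-- The average over the unit sphere `Ω(d)` of the monomial
`z ↦ ∏ i, z i ^ a i * conj (z i) ^ b i`. -/
noncomputable def monomialAvg (d : ℕ) (a b : Fin d → ℕ) : ℂ :=
  if a = b then
    ((Nat.factorial (d - 1) : ℂ) * ∏ i, (Nat.factorial (a i) : ℂ)) /
      (Nat.factorial (d + (∑ i, a i) - 1) : ℂ)
  else 0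

/-- `X` is a complex spherical `T`-design: every monomial of bidegree `(k,l) ∈ T`
has the same average over `X` as over the sphere `Ω(d)`. -/
def IsDesign (d : ℕ) (X : Finset (Fin d → ℂ)) (T : Finset (ℕ × ℕ)) : Prop :=
  ∀ kl ∈ T, ∀ a b : Fin d → ℕ, (∑ i, a i) = kl.1 → (∑ i, b i) = kl.2 →
    (∑ z ∈ X, (∏ i, (z i) ^ (a i)) * ∏ i, ((starRingEnd ℂ) (z i)) ^ (b i))
      = (X.card : ℂ) * monomialAvg d a b

/-- The Jacobi polynomial `g_{k,l}` for the complex sphere in dimension `d`. -/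
noncomputable def jacobi (d k l : ℕ) (x : ℂ) : ℂ :=
  (((d + k + l - 1 : ℕ) : ℂ) / (Nat.factorial (d - 1) : ℂ)) *
    ∑ r ∈ Finset.range (min k l + 1),
      (((-1 : ℂ) ^ r * (Nat.factorial (d + k + l - r - 2) : ℂ)) /
          ((Nat.factorial r : ℂ) * (Nat.factorial (k - r) : ℂ) *
            (Nat.factorial (l - r) : ℂ))) *
        x ^ (k - r) * ((starRingEnd ℂ) x) ^ (l - r)

open scoped Classical in
/-- The inner product set `A(X) = {x^* y : x, y ∈ X, x ≠ y}`. -/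
noncomputable def innerSet {d : ℕ} (X : Finset (Fin d → ℂ)) : Finset ℂ :=
  ((X ×ˢ X).filter fun p => p.1 ≠ p.2).image fun p => cInner p.1 p.2

/-- `m_{k,l}`, the dimension of the harmonic space `Harm(k,l)` in dimension `d`. -/
def mdim (d k l : ℕ) : ℕ :=
  (d + k - 1).choose (d - 1) * (d + l - 1).choose (d - 1) -
    (d + k - 2).choose (d - 1) * (d + l - 2).choose (d - 1)

/-- The convolution `U * V = {(k + l', k' + l) : (k,l) ∈ U, (k',l') ∈ V}`. -/
def convSet (U V : Finset (ℕ × ℕ)) : Finset (ℕ × ℕ) :=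
  (U ×ˢ V).image fun p => (p.1.1 + p.2.2, p.2.1 + p.1.2)

/-- `X` is an `S`-code: it has an annihilator polynomial supported on monomials
`x^k * conj x^l` with `(k,l) ∈ S`. -/
def IsCode (d : ℕ) (X : Finset (Fin d → ℂ)) (S : Finset (ℕ × ℕ)) : Prop :=
  ∃ c : ℕ × ℕ → ℝ,
    (∀ α ∈ innerSet X, ∑ kl ∈ S, (c kl : ℂ) * α ^ kl.1 * ((starRingEnd ℂ) α) ^ kl.2 = 0) ∧
    0 < ∑ kl ∈ S, c kl

theorem beta_nat (q : ℕ) : ∀ p : ℕ, ∫ t in (0:ℝ)..1, t ^ p * (1 - t) ^ q =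
    (p.factorial * q.factorial : ℝ) / ((p + q + 1).factorial : ℝ) := by
  induction q with
  | zero =>
    intro p
    simp [integral_pow, Nat.factorial_succ]
    field_simp
  | succ q ih =>
    intro p
    have h : ∀ t : ℝ, t ^ p * (1 - t) ^ (q + 1) = t ^ p * (1 - t) ^ q - t ^ (p + 1) * (1 - t) ^ q := by
      intro t; ring
    simp_rw [h]
    rw [intervalIntegral.integral_sub (Continuous.intervalIntegrable (by fun_prop) _ _)
      (Continuous.intervalIntegrable (by fun_prop) _ _), ih, ih]
    have e1 : p + 1 + q + 1 = (p + q + 1) + 1 := by ring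
    have e2 : p + (q + 1) + 1 = (p + q + 1) + 1 := by ring
    rw [e1, e2, Nat.factorial_succ (p + q + 1), Nat.factorial_succ p, Nat.factorial_succ q]
    push_cast
    field_simp
    ring

/-- Iterated (stick-breaking) integral over the simplex. -/
noncomputable def simpInt (s : ℕ) : (n : ℕ) → ((Fin n → ℝ) → ℝ) → ℝ
  | 0, F => F (fun _ => 0)
  | n + 1, F => ∫ t in (0:ℝ)..1, (1 - t) ^ (n + s) *
      simpInt s n (fun x => F (Fin.cons t (fun i => (1 - t) * x i)))

theorem simpInt_cont (s : ℕ) (n : ℕ) : ∀ {Y : Type} [TopologicalSpace Y]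
    (F : Y → (Fin n → ℝ) → ℝ), Continuous (fun p : Y × (Fin n → ℝ) => F p.1 p.2) →
    Continuous (fun y => simpInt s n (F y)) := by
  induction n with
  | zero =>
    intro Y _ F hF
    simp only [simpInt]
    exact hF.comp (by fun_prop : Continuous (fun y : Y => (y, fun _ : Fin 0 => (0:ℝ))))
  | succ n ih =>
    intro Y _ F hF
    simp only [simpInt]
    apply intervalIntegral.continuous_parametric_intervalIntegral_of_continuous'
    have := ih (Y := Y × ℝ) (fun p x => F p.1 (Fin.cons p.2 (fun i => (1 - p.2) * x i))) (by
      refine hF.comp (f := fun p : (Y × ℝ) × (Fin n → ℝ) =>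
        (p.1.1, (Fin.cons p.1.2 (fun i => (1 - p.1.2) * p.2 i) : Fin (n+1) → ℝ))) ?_
      refine Continuous.prodMk (by fun_prop) ?_
      refine continuous_pi fun i => ?_
      refine Fin.cases ?_ (fun i => ?_) i
      · simp only [Fin.cons_zero]; fun_prop
      · simp only [Fin.cons_succ]; fun_prop)
    exact Continuous.mul (by fun_prop) this

theorem cons_cont {n : ℕ} : Continuous (fun p : ℝ × (Fin n → ℝ) =>
    (Fin.cons p.1 (fun i => (1 - p.1) * p.2 i) : Fin (n+1) → ℝ)) := by
  refine continuous_pi fun i => ?_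
  refine Fin.cases ?_ (fun i => ?_) i
  · simp only [Fin.cons_zero]; fun_prop
  · simp only [Fin.cons_succ]; fun_prop

theorem simpInt_cont' (s n : ℕ) (F : (Fin (n+1) → ℝ) → ℝ) (hF : Continuous F) :
    Continuous (fun t : ℝ => (1 - t) ^ (n + s) *
      simpInt s n (fun x => F (Fin.cons t (fun i => (1 - t) * x i)))) :=
  Continuous.mul (by fun_prop) (simpInt_cont s n _ (hF.comp cons_cont))

theorem cons_cont_t {n : ℕ} (t : ℝ) : Continuous (fun x : (Fin n → ℝ) =>
    (Fin.cons t (fun i => (1 - t) * x i) : Fin (n+1) → ℝ)) :=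
  cons_cont.comp (by fun_prop : Continuous (fun x : Fin n → ℝ => (t, x)))

theorem simpInt_add (s n : ℕ) : ∀ (F G : (Fin n → ℝ) → ℝ), Continuous F → Continuous G →
    simpInt s n (fun x => F x + G x) = simpInt s n F + simpInt s n G := by
  induction n with
  | zero => intro F G _ _; rfl
  | succ n ih =>
    intro F G hF hG
    simp only [simpInt]
    rw [← intervalIntegral.integral_add ((simpInt_cont' s n F hF).intervalIntegrable _ _)
      ((simpInt_cont' s n G hG).intervalIntegrable _ _)]
    congr 1
    funext t
    have := ih _ _ (hF.comp (cons_cont_t t)) (hG.comp (cons_cont_t t))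
    simp only [Function.comp_def] at this
    rw [this, mul_add]

theorem simpInt_smul (s n : ℕ) : ∀ (c : ℝ) (F : (Fin n → ℝ) → ℝ),
    simpInt s n (fun x => c * F x) = c * simpInt s n F := by
  induction n with
  | zero => intro c F; rfl
  | succ n ih =>
    intro c F
    simp only [simpInt]
    rw [← intervalIntegral.integral_const_mul]
    congr 1
    funext t
    rw [ih]; ring

theorem simpInt_sum {ι : Type*} (s n : ℕ) (P : Finset ι) (F : ι → (Fin n → ℝ) → ℝ)
    (hF : ∀ i, Continuous (F i)) :
    simpInt s n (fun x => ∑ i ∈ P, F i x) = ∑ i ∈ P, simpInt s n (F i) := by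
  induction P using Finset.cons_induction with
  | empty =>
    have := simpInt_smul s n 0 (fun _ => 0)
    simpa using this
  | cons a P ha ih =>
    simp only [Finset.sum_cons]
    rw [simpInt_add s n _ _ (hF a) (continuous_finsetSum _ fun i _ => hF i), ih]

theorem simpInt_monomial (s n : ℕ) : ∀ (m : Fin n → ℕ),
    simpInt s n (fun x => ∏ i, x i ^ m i) =
      ((s.factorial : ℝ) * ∏ i, ((m i).factorial : ℝ)) / ((n + s + ∑ i, m i).factorial : ℝ) := by
  induction n with
  | zero => intro m; simp [simpInt]; field_simp
  | succ n ih =>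
    intro m
    simp only [simpInt, Fin.prod_univ_succ, Fin.cons_zero, Fin.cons_succ, mul_pow,
      Finset.prod_mul_distrib]
    have h : ∀ t : ℝ, (1 - t) ^ (n + s) * simpInt s n (fun x => t ^ m 0 *
        ((∏ i : Fin n, (1 - t) ^ m i.succ) * ∏ i : Fin n, x i ^ m i.succ)) =
        (((s.factorial : ℝ) * ∏ i : Fin n, ((m i.succ).factorial : ℝ)) /
          ((n + s + ∑ i : Fin n, m i.succ).factorial : ℝ)) *
        (t ^ m 0 * (1 - t) ^ (n + s + ∑ i : Fin n, m i.succ)) := by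
      intro t
      rw [simpInt_smul, simpInt_smul, ih, Finset.prod_pow_eq_pow_sum]
      ring
    simp_rw [h]
    rw [intervalIntegral.integral_const_mul, beta_nat, Fin.sum_univ_succ]
    have e : n + 1 + s + (m 0 + ∑ i : Fin n, m i.succ) =
      m 0 + (n + s + ∑ i : Fin n, m i.succ) + 1 := by ring
    rw [e]
    field_simp

theorem simpInt_nonneg (s n : ℕ) : ∀ (F : (Fin n → ℝ) → ℝ),
    (∀ x, (∀ i, 0 ≤ x i) → 0 ≤ F x) → 0 ≤ simpInt s n F := by
  induction n with
  | zero => intro F h; exact h _ (fun _ => le_rfl)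
  | succ n ih =>
    intro F h
    simp only [simpInt]
    refine intervalIntegral.integral_nonneg zero_le_one fun t ht => ?_
    have h1 : 0 ≤ 1 - t := by linarith [ht.2]
    refine mul_nonneg (pow_nonneg h1 _) (ih _ fun x hx => h _ fun i => ?_)
    refine Fin.cases ?_ (fun i => ?_) i
    · simpa using ht.1
    · simpa using mul_nonneg h1 (hx i)

theorem simpInt_eq_zero (s n : ℕ) : ∀ (F : (Fin n → ℝ) → ℝ), Continuous F →
    (∀ x, (∀ i, 0 ≤ x i) → 0 ≤ F x) → simpInt s n F = 0 →
    ∀ x, (∀ i, 0 < x i) → ∑ i, x i < 1 → F x = 0 := by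
  induction n with
  | zero =>
    intro F _ _ h x _ _
    simp only [simpInt] at h
    rw [← h]; congr 1; exact Subsingleton.elim _ _
  | succ n ih =>
    intro F hF hpos h x hx hx1
    simp only [simpInt] at h
    rw [Fin.sum_univ_succ] at hx1
    have hs : 0 ≤ ∑ i : Fin n, x i.succ := Finset.sum_nonneg fun i _ => (hx _).le
    have hp : ∀ t : ℝ, 0 ≤ t → t ≤ 1 → ∀ y : Fin n → ℝ, (∀ i, 0 ≤ y i) →
        0 ≤ F (Fin.cons t (fun i => (1 - t) * y i)) := by
      intro t h0 h1 y hy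
      refine hpos _ fun i => ?_
      refine Fin.cases ?_ (fun i => ?_) i
      · simpa using h0
      · simpa using mul_nonneg (sub_nonneg.2 h1) (hy i)
    have ht1 : 0 < 1 - x 0 := by linarith
    have key : simpInt s n (fun y => F (Fin.cons (x 0) (fun i => (1 - x 0) * y i))) = 0 := by
      by_contra hne
      have hge := simpInt_nonneg s n _ (hp (x 0) (hx 0).le (by linarith))
      have hgt := lt_of_le_of_ne hge (Ne.symm hne)
      have := intervalIntegral.integral_pos zero_lt_one (simpInt_cont' s n F hF).continuousOn
        (fun t ht => mul_nonneg (pow_nonneg (by linarith [ht.2]) _)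
          (simpInt_nonneg s n _ (hp t ht.1.le ht.2)))
        ⟨x 0, ⟨(hx 0).le, by linarith⟩, mul_pos (pow_pos ht1 _) hgt⟩
      exact this.ne' h
    have := ih _ (hF.comp (cons_cont_t (x 0))) (hp (x 0) (hx 0).le (by linarith)) key
      (fun i => x i.succ / (1 - x 0)) (fun i => div_pos (hx _) ht1)
      (by rw [← Finset.sum_div, div_lt_one ht1]; linarith)
    simp only [Function.comp_def] at this
    rw [← this]
    congr 1
    funext i
    refine Fin.cases ?_ (fun i => ?_) i
    · simp
    · simp; field_simp

/-- real polynomial vanishing near the origin in the positive orthant -/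
theorem poly_coeff_zero {ι : Type*} (n : ℕ) (P : Finset ι) (c : ι → Fin n → ℕ)
    (hc : Set.InjOn c P) (f : ι → ℝ)
    (h : ∀ x : Fin n → ℝ, (∀ i, 0 < x i) → ∑ i, x i < 1 → ∑ p ∈ P, f p * ∏ i, x i ^ c p i = 0) :
    ∀ p ∈ P, f p = 0 := by
  set Q : MvPolynomial (Fin n) ℝ :=
    ∑ p ∈ P, MvPolynomial.monomial (Finsupp.equivFunOnFinite.symm (c p)) (f p) with hQ
  have hQ0 : Q = 0 := by
    refine MvPolynomial.funext_set (fun _ => Set.Ioo (0:ℝ) (1 / (n + 1)))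
      (fun _ => Set.Ioo_infinite (by positivity)) fun x hx => ?_
    have hx' : ∀ i, 0 < x i ∧ x i < 1 / (n + 1) := fun i => hx i (Set.mem_univ i)
    have hsum : ∑ i, x i < 1 := by
      have h1 : ∑ i, x i ≤ ∑ i : Fin n, (1 / (n + 1) : ℝ) :=
        Finset.sum_le_sum fun i _ => (hx' i).2.le
      refine h1.trans_lt ?_
      simp
      rw [← div_eq_mul_inv, div_lt_one (by positivity)]
      linarith
    rw [map_zero, hQ, map_sum, ← h x (fun i => (hx' i).1) hsum]
    refine Finset.sum_congr rfl fun p _ => ?_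
    rw [MvPolynomial.eval_monomial, Finsupp.prod_fintype _ _ (by simp)]
    simp
  intro p hp
  have := congrArg (MvPolynomial.coeff (Finsupp.equivFunOnFinite.symm (c p))) hQ0
  rw [hQ, MvPolynomial.coeff_sum, MvPolynomial.coeff_zero, Finset.sum_eq_single p] at this
  · simpa using this
  · intro q hq hqp
    rw [MvPolynomial.coeff_monomial, if_neg]
    intro he
    exact hqp (hc hq hp (Finsupp.equivFunOnFinite.symm.injective he))
  · intro hn; exact absurd hp hn

theorem kernel_pd {ι : Type*} (s n : ℕ) (g : Fin n → ℕ) (P : Finset ι) (c : ι → Fin n → ℕ)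
    (hc : Set.InjOn c P) (f : ι → ℂ)
    (h : ∑ p ∈ P, ∑ q ∈ P, f p * (starRingEnd ℂ) (f q) *
      (((((s.factorial : ℝ) * ∏ i, ((g i + c p i + c q i).factorial : ℝ)) /
        ((n + s + ∑ i, (g i + c p i + c q i)).factorial : ℝ)) : ℝ) : ℂ) = 0) :
    ∀ p ∈ P, f p = 0 := by
  set F : (Fin n → ℝ) → ℝ := fun x => (∏ i, x i ^ g i) *
    ((∑ p ∈ P, (f p).re * ∏ i, x i ^ c p i) ^ 2 + (∑ p ∈ P, (f p).im * ∏ i, x i ^ c p i) ^ 2) with hF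
  have hFc : Continuous F := by fun_prop
  have hFe : F = fun x => ∑ p ∈ P, ∑ q ∈ P, ((f p).re * (f q).re + (f p).im * (f q).im) *
      ∏ i, x i ^ (g i + c p i + c q i) := by
    funext x
    simp only [hF, sq, Finset.sum_mul_sum, pow_add, Finset.prod_mul_distrib]
    rw [← Finset.sum_add_distrib, Finset.mul_sum]
    refine Finset.sum_congr rfl fun p _ => ?_
    rw [← Finset.sum_add_distrib, Finset.mul_sum]
    refine Finset.sum_congr rfl fun q _ => ?_
    ring
  have hint : simpInt s n F = 0 := by
    rw [hFe, simpInt_sum _ _ _ _ (fun p => by fun_prop)]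
    have := congrArg Complex.re h
    rw [Complex.re_sum, Complex.zero_re] at this
    rw [← this]
    refine Finset.sum_congr rfl fun p _ => ?_
    rw [simpInt_sum _ _ _ _ (fun p => by fun_prop), Complex.re_sum]
    refine Finset.sum_congr rfl fun q _ => ?_
    rw [simpInt_smul, simpInt_monomial s n (fun i => g i + c p i + c q i), Complex.re_mul_ofReal]
    simp
  have hz := simpInt_eq_zero s n F hFc (fun x hx => mul_nonneg
    (Finset.prod_nonneg fun i _ => pow_nonneg (hx i) _) (by positivity)) hint
  have hz' : ∀ x : Fin n → ℝ, (∀ i, 0 < x i) → ∑ i, x i < 1 →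
      (∑ p ∈ P, (f p).re * ∏ i, x i ^ c p i) = 0 ∧ (∑ p ∈ P, (f p).im * ∏ i, x i ^ c p i) = 0 := by
    intro x hx hx1
    have h1 := hz x hx hx1
    have h2 : (∏ i, x i ^ g i) ≠ 0 := (Finset.prod_pos fun i _ => pow_pos (hx i) _).ne'
    have h3 := (mul_eq_zero.1 h1).resolve_left h2
    constructor <;> nlinarith [sq_nonneg (∑ p ∈ P, (f p).re * ∏ i, x i ^ c p i),
      sq_nonneg (∑ p ∈ P, (f p).im * ∏ i, x i ^ c p i)]
  intro p hp
  apply Complex.ext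
  · exact poly_coeff_zero n P c hc (fun p => (f p).re) (fun x hx h1 => (hz' x hx h1).1) p hp
  · exact poly_coeff_zero n P c hc (fun p => (f p).im) (fun x hx h1 => (hz' x hx h1).2) p hp

/-- the monomial function attached to a pair of exponents -/
noncomputable def monFn {n : ℕ} (p : (Fin n → ℕ) × (Fin n → ℕ)) (z : Fin n → ℂ) : ℂ :=
  (∏ i, (z i) ^ (p.1 i)) * ∏ i, ((starRingEnd ℂ) (z i)) ^ (p.2 i)

theorem monFn_mul_conj {n : ℕ} (p q : (Fin n → ℕ) × (Fin n → ℕ)) (z : Fin n → ℂ) :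
    monFn p z * (starRingEnd ℂ) (monFn q z) =
      (∏ i, (z i) ^ ((p.1 + q.2) i)) * ∏ i, ((starRingEnd ℂ) (z i)) ^ ((p.2 + q.1) i) := by
  simp only [monFn, map_mul, map_prod, map_pow, Complex.conj_conj, Pi.add_apply, pow_add,
    Finset.prod_mul_distrib]
  ring

theorem core_indep {n : ℕ} (X : Finset (Fin (n + 1) → ℂ)) (hX : X.Nonempty)
    (T U : Finset (ℕ × ℕ)) (hdesign : IsDesign (n + 1) X T) (hUU : convSet U U ⊆ T)
    (S : Finset ((Fin (n + 1) → ℕ) × (Fin (n + 1) → ℕ)))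
    (hS0 : ∀ p ∈ S, p.1 0 = 0 ∨ p.2 0 = 0)
    (hSU : ∀ p ∈ S, (∑ i, p.1 i, ∑ i, p.2 i) ∈ U)
    (f : (Fin (n + 1) → ℕ) × (Fin (n + 1) → ℕ) → ℂ)
    (hf : ∀ z ∈ X, ∑ p ∈ S, f p * monFn p z = 0) : ∀ p ∈ S, f p = 0 := by
  classical
  intro p0 hp0
  set P := S.filter (fun p => ∀ i, p.1 i + p0.2 i = p.2 i + p0.1 i) with hP
  have hPS : P ⊆ S := Finset.filter_subset _ _
  have hPm : ∀ p ∈ P, ∀ i, p.1 i + p0.2 i = p.2 i + p0.1 i := fun p hp =>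
    (Finset.mem_filter.1 hp).2
  have hp0P : p0 ∈ P := Finset.mem_filter.2 ⟨hp0, fun i => Nat.add_comm _ _⟩
  have hXc : (X.card : ℂ) ≠ 0 := by exact_mod_cast hX.card_pos.ne'
  have hdes : ∀ p ∈ S, ∀ q ∈ S, ∑ z ∈ X, monFn p z * (starRingEnd ℂ) (monFn q z) =
      X.card * monomialAvg (n + 1) (p.1 + q.2) (p.2 + q.1) := by
    intro p hp q hq
    simp_rw [monFn_mul_conj]
    refine hdesign (∑ i, p.1 i + ∑ i, q.2 i, ∑ i, q.1 i + ∑ i, p.2 i) (hUU ?_) _ _ ?_ ?_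
    · exact Finset.mem_image.2 ⟨(_, _), Finset.mem_product.2 ⟨hSU p hp, hSU q hq⟩, rfl⟩
    · simp [Finset.sum_add_distrib]
    · simp [Finset.sum_add_distrib, add_comm]
  have h1 : ∑ z ∈ X, (∑ p ∈ S, f p * monFn p z) *
      (starRingEnd ℂ) (∑ q ∈ P, f q * monFn q z) = 0 :=
    Finset.sum_eq_zero fun z hz => by rw [hf z hz, zero_mul]
  have h2 : ∑ p ∈ S, ∑ q ∈ P, f p * (starRingEnd ℂ) (f q) *
      (X.card * monomialAvg (n + 1) (p.1 + q.2) (p.2 + q.1)) = 0 := by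
    rw [← h1]
    simp_rw [map_sum, Finset.sum_mul_sum]
    rw [Finset.sum_comm (s := X)]
    refine Finset.sum_congr rfl fun p hp => ?_
    rw [Finset.sum_comm (s := X)]
    refine Finset.sum_congr rfl fun q hq => ?_
    rw [← hdes p hp q (hPS hq), Finset.mul_sum]
    refine Finset.sum_congr rfl fun z _ => ?_
    rw [map_mul]; ring
  have h3 : ∑ p ∈ P, ∑ q ∈ P, f p * (starRingEnd ℂ) (f q) *
      (X.card * monomialAvg (n + 1) (p.1 + q.2) (p.2 + q.1)) = 0 := by
    rw [← h2]
    refine Finset.sum_subset hPS fun p hp hpP => Finset.sum_eq_zero fun q hq => ?_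
    rw [monomialAvg, if_neg, mul_zero, mul_zero]
    intro he
    refine hpP (Finset.mem_filter.2 ⟨hp, fun i => ?_⟩)
    have e1 := congrFun he i
    have e2 := hPm q hq i
    simp only [Pi.add_apply] at e1
    omega
  set s : ℕ := (p0.1 0 - p0.2 0) + (p0.2 0 - p0.1 0) with hs
  set g : Fin n → ℕ := fun i => (p0.1 i.succ - p0.2 i.succ) + (p0.2 i.succ - p0.1 i.succ) with hg
  set c : (Fin (n + 1) → ℕ) × (Fin (n + 1) → ℕ) → Fin n → ℕ :=
    fun p i => min (p.1 i.succ) (p.2 i.succ) with hc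
  refine kernel_pd s n g P c ?_ f ?_ p0 hp0P
  · intro p hp q hq hpq
    have hp' := hPm p hp
    have hq' := hPm q hq
    have hz1 := hS0 p (hPS hp)
    have hz2 := hS0 q (hPS hq)
    have hall : ∀ i, p.1 i = q.1 i ∧ p.2 i = q.2 i := by
      intro i
      refine Fin.cases ?_ (fun i => ?_) i
      · have := hp' 0; have := hq' 0; omega
      · have := hp' i.succ; have := hq' i.succ
        have := congrFun hpq i
        simp only [hc] at this
        omega
    exact Prod.ext (funext fun i => (hall i).1) (funext fun i => (hall i).2)
  · have hk : (X.card * (n.factorial : ℂ)) ≠ 0 :=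
      mul_ne_zero hXc (by exact_mod_cast n.factorial_ne_zero)
    refine (mul_eq_zero.1 (?_ : (X.card * (n.factorial : ℂ)) * _ = 0)).resolve_left hk
    rw [← h3, Finset.mul_sum]
    refine Finset.sum_congr rfl fun p hp => ?_
    rw [Finset.mul_sum]
    refine Finset.sum_congr rfl fun q hq => ?_
    have hp' := hPm p hp
    have hq' := hPm q hq
    have hz1 := hS0 p (hPS hp)
    have hz2 := hS0 q (hPS hq)
    have e0 : (p.1 + q.2) 0 = s := by
      have := hp' 0; have := hq' 0
      simp only [Pi.add_apply]
      omega
    have ei : ∀ i : Fin n, (p.1 + q.2) i.succ = g i + c p i + c q i := by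
      intro i
      have := hp' i.succ; have := hq' i.succ
      simp only [Pi.add_apply, hg, hc]
      omega
    have heq : p.1 + q.2 = p.2 + q.1 := by
      funext i
      have := hp' i; have := hq' i
      simp only [Pi.add_apply]
      omega
    rw [monomialAvg, if_pos heq, Fin.prod_univ_succ, Fin.sum_univ_succ, e0]
    simp_rw [ei]
    have e : n + 1 + (s + ∑ i, (g i + c p i + c q i)) - 1 = n + s + ∑ i, (g i + c p i + c q i) := by
      omega
    rw [e]
    push_cast
    try simp only [Nat.add_sub_cancel]
    ring

theorem card_anti (n k : ℕ) :
    (Finset.piAntidiag (Finset.univ : Finset (Fin (n + 1))) k).card = (n + k).choose n := by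
  have h := Finset.card_finsuppAntidiag_nat_eq_choose (s := (Finset.univ : Finset (Fin (n + 1)))) k
  have h2 : (Finset.finsuppAntidiag (Finset.univ : Finset (Fin (n + 1))) k).card =
      (Finset.piAntidiag (Finset.univ : Finset (Fin (n + 1))) k).card := by
    simp [Finset.finsuppAntidiag]
  rw [← h2, h]
  simp only [Finset.card_univ, Fintype.card_fin]
  rw [show n + 1 + k - 1 = n + k by omega, Nat.choose_symm_add]

theorem card_bad (n k : ℕ) (hk : k ≠ 0) :
    ((Finset.piAntidiag (Finset.univ : Finset (Fin (n + 1))) k).filter (fun a => a 0 ≠ 0)).card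
      ≤ (n + 1 + k - 2).choose n := by
  obtain ⟨k, rfl⟩ := Nat.exists_eq_succ_of_ne_zero hk
  rw [show n + 1 + (k + 1) - 2 = n + k by omega, ← card_anti]
  refine Finset.card_le_card_of_injOn (fun a => Fin.cons (a 0 - 1) (fun i => a i.succ)) ?_ ?_
  · intro a ha
    simp only [Finset.coe_filter, Finset.mem_piAntidiag, Set.mem_ofPred_eq, Fin.sum_univ_succ] at ha
    simp only [Finset.mem_coe, Finset.mem_piAntidiag, Fin.sum_univ_succ, Fin.cons_zero,
      Fin.cons_succ]
    refine ⟨?_, fun _ _ => Finset.mem_univ _⟩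
    omega
  · intro a ha b hb hab
    simp only [Finset.coe_filter, Set.mem_ofPred_eq] at ha hb
    funext i
    refine Fin.cases ?_ (fun i => ?_) i
    · have := congrFun hab 0
      simp only [Fin.cons_zero] at this
      omega
    · have := congrFun hab i.succ
      simpa using this

/-- reduced pairs of exponents of bidegree `kl` -/
def redPairs (n : ℕ) (kl : ℕ × ℕ) : Finset ((Fin (n + 1) → ℕ) × (Fin (n + 1) → ℕ)) :=
  ((Finset.piAntidiag Finset.univ kl.1) ×ˢ (Finset.piAntidiag Finset.univ kl.2)).filter
    (fun p => p.1 0 = 0 ∨ p.2 0 = 0)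

theorem mdim_le (n : ℕ) (kl : ℕ × ℕ) : mdim (n + 1) kl.1 kl.2 ≤ (redPairs n kl).card := by
  obtain ⟨k, l⟩ := kl
  have h1 := Finset.card_filter_add_card_filter_not
    (s := (Finset.piAntidiag (Finset.univ : Finset (Fin (n + 1))) k) ×ˢ
      (Finset.piAntidiag (Finset.univ : Finset (Fin (n + 1))) l))
    (fun p => p.1 0 = 0 ∨ p.2 0 = 0)
  have h2 : (((Finset.piAntidiag (Finset.univ : Finset (Fin (n + 1))) k) ×ˢ
      (Finset.piAntidiag (Finset.univ : Finset (Fin (n + 1))) l)).filter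
      (fun p => ¬ (p.1 0 = 0 ∨ p.2 0 = 0))).card ≤
      (n + 1 + k - 2).choose n * (n + 1 + l - 2).choose n := by
    have e : (((Finset.piAntidiag (Finset.univ : Finset (Fin (n + 1))) k) ×ˢ
      (Finset.piAntidiag (Finset.univ : Finset (Fin (n + 1))) l)).filter
      (fun p => ¬ (p.1 0 = 0 ∨ p.2 0 = 0))) =
      ((Finset.piAntidiag (Finset.univ : Finset (Fin (n + 1))) k).filter (fun a => a 0 ≠ 0)) ×ˢ
      ((Finset.piAntidiag (Finset.univ : Finset (Fin (n + 1))) l).filter (fun a => a 0 ≠ 0)) := by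
      ext p
      simp only [Finset.mem_filter, Finset.mem_product, not_or]
      tauto
    rw [e, Finset.card_product]
    by_cases hk : k = 0
    · subst hk; simp [Finset.filter_singleton]
    by_cases hl : l = 0
    · subst hl; simp [Finset.filter_singleton]
    exact Nat.mul_le_mul (card_bad n k hk) (card_bad n l hl)
  rw [Finset.card_product, card_anti, card_anti] at h1
  simp only [mdim, redPairs, Nat.add_sub_cancel]
  rw [show n + 1 + k - 1 = n + k by omega, show n + 1 + l - 1 = n + l by omega]
  omega

open scoped Classical

/-- absolute bound for designs: if `X` is a `T`-design and
`U * U ⊆ T` for a lower set `U`, then `|X| ≥ ∑_{(k,l)∈U} m_{k,l}`. -/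
theorem stmt_6 {d : ℕ} (hd : 1 ≤ d) (X : Finset (Fin d → ℂ)) (hXne : X.Nonempty)
    (hXsphere : ∀ x ∈ X, cInner x x = 1)
    (T U : Finset (ℕ × ℕ)) (hT : IsLowerSet' T) (hU : IsLowerSet' U)
    (hdesign : IsDesign d X T) (hUU : convSet U U ⊆ T) :
    ∑ kl ∈ U, mdim d kl.1 kl.2 ≤ X.card := by
  obtain ⟨n, rfl⟩ : ∃ n, d = n + 1 := ⟨d - 1, by omega⟩
  have hmem : ∀ kl p, p ∈ redPairs n kl →
      ((∑ i, p.1 i) = kl.1 ∧ (∑ i, p.2 i) = kl.2) ∧ (p.1 0 = 0 ∨ p.2 0 = 0) := by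
    intro kl p hp
    simp only [redPairs, Finset.mem_filter, Finset.mem_product, Finset.mem_piAntidiag] at hp
    exact ⟨⟨hp.1.1.1, hp.1.2.1⟩, hp.2⟩
  set S := U.biUnion (redPairs n) with hS
  have hcard : ∑ kl ∈ U, mdim (n + 1) kl.1 kl.2 ≤ S.card := by
    rw [hS, Finset.card_biUnion]
    · exact Finset.sum_le_sum fun kl _ => mdim_le n kl
    · intro x _ y _ hxy
      rw [Function.onFun, Finset.disjoint_left]
      intro p hp hp'
      have h1 := (hmem x p hp).1
      have h2 := (hmem y p hp').1
      exact hxy (Prod.ext (h1.1.symm.trans h2.1) (h1.2.symm.trans h2.2))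
  refine hcard.trans ?_
  have hli : LinearIndepOn ℂ (fun p => fun z : X => monFn p z.1) (S : Set _) := by
    rw [linearIndepOn_finset_iff]
    intro f hf
    refine core_indep X hXne T U hdesign hUU S ?_ ?_ f ?_
    · intro p hp
      obtain ⟨kl, _, h⟩ := Finset.mem_biUnion.1 hp
      exact (hmem kl p h).2
    · intro p hp
      obtain ⟨kl, hkl, h⟩ := Finset.mem_biUnion.1 hp
      rw [(hmem kl p h).1.1, (hmem kl p h).1.2]
      exact hkl
    · intro z hz
      have := congrFun hf ⟨z, hz⟩
      simpa using this
  have := LinearIndependent.fintype_card_le_finrank hli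
  simpa using this
end

section
/- Let d ≥ 2, let 𝒯 be a lower set, and let X ⊆ Ω(d) be a complex spherical 𝒯-design. Let f : ℕ×ℕ → ℝ be finitely supported with f_{0,0} > 0 and f_{k,l} ≤ 0 whenever (k,l) ∉ 𝒯, and define F(x) = Σ_{(k,l)} f_{k,l}·g_{k,l}(x). If for every α ∈ A(X) the value F(α) is a nonnegative real number, then |X| ≥ F(1)/f_{0,0}. -/
open Finset

namespace LP

open MvPolynomial

/-! ### Fischer inner product -/

/-- Fischer weight of a multi-index: product of factorials. -/
noncomputable def fw {σ : Type} [Fintype σ] (a : σ →₀ ℕ) : ℝ := ∏ i, (Nat.factorial (a i) : ℝ)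

/-- Fischer inner product. -/
noncomputable def fis {σ : Type} [Fintype σ] (p q : MvPolynomial σ ℂ) : ℂ :=
  ∑ a ∈ p.support, (fw a : ℂ) * (starRingEnd ℂ) (coeff a p) * coeff a q

lemma fis_eq_of_subset {σ : Type} [Fintype σ] (p q : MvPolynomial σ ℂ) (S : Finset (σ →₀ ℕ))
    (h : p.support ⊆ S) :
    fis p q = ∑ a ∈ S, (fw a : ℂ) * (starRingEnd ℂ) (coeff a p) * coeff a q := by
  unfold fis
  apply Finset.sum_subset h
  intro a _ ha
  rw [MvPolynomial.notMem_support_iff] at ha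
  simp [ha]

lemma fis_add_left {σ : Type} [Fintype σ] (p p' q : MvPolynomial σ ℂ) :
    fis (p + p') q = fis p q + fis p' q := by
  classical
  rw [fis_eq_of_subset (p + p') q (p.support ∪ p'.support) MvPolynomial.support_add,
    fis_eq_of_subset p q (p.support ∪ p'.support) Finset.subset_union_left,
    fis_eq_of_subset p' q (p.support ∪ p'.support) Finset.subset_union_right,
    ← Finset.sum_add_distrib]
  refine Finset.sum_congr rfl fun a _ => ?_
  simp only [coeff_add, map_add]
  ring

lemma fis_C_mul_left {σ : Type} [Fintype σ] (c : ℂ) (p q : MvPolynomial σ ℂ) :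
    fis (C c * p) q = (starRingEnd ℂ) c * fis p q := by
  rw [fis_eq_of_subset (C c * p) q p.support, fis, Finset.mul_sum]
  · refine Finset.sum_congr rfl fun a _ => ?_
    simp only [coeff_C_mul, map_mul]
    ring
  · intro a ha
    rw [MvPolynomial.mem_support_iff] at ha ⊢
    rw [coeff_C_mul] at ha
    exact right_ne_zero_of_mul ha

lemma fis_zero_left {σ : Type} [Fintype σ] (q : MvPolynomial σ ℂ) : fis 0 q = 0 := by
  simp [fis]

lemma fis_sum_left {σ ι : Type} [Fintype σ] (s : Finset ι) (p : ι → MvPolynomial σ ℂ)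
    (q : MvPolynomial σ ℂ) : fis (∑ i ∈ s, p i) q = ∑ i ∈ s, fis (p i) q := by
  classical
  induction s using Finset.induction_on with
  | empty => simp [fis]
  | insert a s ha ih => rw [Finset.sum_insert ha, Finset.sum_insert ha, fis_add_left, ih]

lemma fis_sum_right {σ ι : Type} [Fintype σ] (s : Finset ι) (p : MvPolynomial σ ℂ)
    (q : ι → MvPolynomial σ ℂ) : fis p (∑ i ∈ s, q i) = ∑ i ∈ s, fis p (q i) := by
  unfold fis
  rw [Finset.sum_comm]
  refine Finset.sum_congr rfl fun a _ => ?_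
  rw [coeff_sum, Finset.mul_sum]

lemma fis_C_mul_right {σ : Type} [Fintype σ] (c : ℂ) (p q : MvPolynomial σ ℂ) :
    fis p (C c * q) = c * fis p q := by
  unfold fis
  rw [Finset.mul_sum]
  refine Finset.sum_congr rfl fun a _ => ?_
  simp only [coeff_C_mul]
  ring

lemma fis_zero_right {σ : Type} [Fintype σ] (q : MvPolynomial σ ℂ) : fis q 0 = 0 := by
  simp [fis]

lemma fis_self_nonneg {σ : Type} [Fintype σ] (p : MvPolynomial σ ℂ) : 0 ≤ (fis p p).re := by
  unfold fis
  rw [Complex.re_sum]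
  refine Finset.sum_nonneg fun a _ => ?_
  have : (fw a : ℂ) * (starRingEnd ℂ) (coeff a p) * coeff a p
      = ((fw a * Complex.normSq (coeff a p) : ℝ) : ℂ) := by
    rw [mul_assoc, mul_comm ((starRingEnd ℂ) _), Complex.mul_conj]
    push_cast
    rfl
  rw [this, Complex.ofReal_re]
  have : 0 ≤ fw a := Finset.prod_nonneg fun i _ => by positivity
  exact mul_nonneg this (Complex.normSq_nonneg _)

lemma fw_add_single {σ : Type} [Fintype σ] (a : σ →₀ ℕ) (s : σ) :
    fw (a + Finsupp.single s 1) = (a s + 1) * fw a := by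
  classical
  unfold fw
  rw [← Finset.mul_prod_erase _ _ (Finset.mem_univ s),
    ← Finset.mul_prod_erase _ (fun i => ((a i).factorial : ℝ)) (Finset.mem_univ s)]
  have : ∏ i ∈ Finset.univ.erase s, (((a + Finsupp.single s 1 : σ →₀ ℕ) i).factorial : ℝ)
      = ∏ i ∈ Finset.univ.erase s, ((a i).factorial : ℝ) := by
    refine Finset.prod_congr rfl fun i hi => ?_
    have : s ≠ i := (Finset.ne_of_mem_erase hi).symm
    simp [Finsupp.single_apply, this]
  rw [this]
  simp only [Finsupp.coe_add, Pi.add_apply, Finsupp.single_eq_same, Nat.factorial_succ]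
  push_cast
  ring

lemma fis_X_mul {σ : Type} [Fintype σ] (s : σ) (p q : MvPolynomial σ ℂ) :
    fis (X s * p) q = fis p (pderiv s q) := by
  unfold fis
  rw [support_X_mul, Finset.sum_map]
  refine Finset.sum_congr rfl fun a _ => ?_
  simp only [addLeftEmbedding_apply, coeff_X_mul, coeff_pderiv]
  rw [add_comm, fw_add_single]
  push_cast
  ring

lemma isWH_pderiv {σ : Type} (w : σ → ℕ) (q : MvPolynomial σ ℂ) (n m : ℕ) (i : σ)
    (hq : IsWeightedHomogeneous w q n) (h : n = m + w i) :
    IsWeightedHomogeneous w (pderiv i q) m := by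
  intro a ha
  rw [coeff_pderiv] at ha
  have := hq (left_ne_zero_of_mul ha)
  rw [map_add, Finsupp.weight_single] at this
  simp at this
  omega

/-! ### The polynomials on `ℂ^d ⊕ ℂ^d` -/

variable {d : ℕ}

/-- Polynomials in `z` and `conj z`. -/
abbrev PP (d : ℕ) := MvPolynomial (Fin d ⊕ Fin d) ℂ

/-- linear form `z ↦ x^* z` -/
noncomputable def fA (x : Fin d → ℂ) : PP d := ∑ i, C ((starRingEnd ℂ) (x i)) * X (Sum.inl i)

/-- linear form `z ↦ z^* x` -/
noncomputable def fB (x : Fin d → ℂ) : PP d := ∑ i, C (x i) * X (Sum.inr i)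

/-- squared norm -/
noncomputable def fN (d : ℕ) : PP d := ∑ i, X (Sum.inl i) * X (Sum.inr i)

/-- Laplacian -/
noncomputable def lap (q : PP d) : PP d := ∑ i, pderiv (Sum.inl i) (pderiv (Sum.inr i) q)

/-- evaluation point -/
noncomputable def ept (x : Fin d → ℂ) : Fin d ⊕ Fin d → ℂ :=
  Sum.elim x (fun i => (starRingEnd ℂ) (x i))

def w1 (d : ℕ) : Fin d ⊕ Fin d → ℕ := Sum.elim (fun _ => 1) (fun _ => 0)
def w2 (d : ℕ) : Fin d ⊕ Fin d → ℕ := Sum.elim (fun _ => 0) (fun _ => 1)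

lemma fis_fN_mul (p q : PP d) : fis (fN d * p) q = fis p (lap q) := by
  unfold fN lap
  rw [Finset.sum_mul, fis_sum_left, fis_sum_right]
  refine Finset.sum_congr rfl fun i _ => ?_
  rw [mul_comm (X (Sum.inl i)), mul_assoc, fis_X_mul, fis_X_mul]

lemma fis_fA_mul (x : Fin d → ℂ) (p q : PP d) :
    fis (fA x * p) q = fis p (∑ i, C (x i) * pderiv (Sum.inl i) q) := by
  unfold fA
  rw [Finset.sum_mul, fis_sum_left, fis_sum_right]
  refine Finset.sum_congr rfl fun i _ => ?_
  rw [mul_assoc, fis_C_mul_left, fis_X_mul, fis_C_mul_right, Complex.conj_conj]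

lemma fis_fB_mul (x : Fin d → ℂ) (p q : PP d) :
    fis (fB x * p) q = fis p (∑ i, C ((starRingEnd ℂ) (x i)) * pderiv (Sum.inr i) q) := by
  unfold fB
  rw [Finset.sum_mul, fis_sum_left, fis_sum_right]
  refine Finset.sum_congr rfl fun i _ => ?_
  rw [mul_assoc, fis_C_mul_left, fis_X_mul, fis_C_mul_right]

lemma euler1 (x : Fin d → ℂ) (q : PP d) (n : ℕ) (hq : IsWeightedHomogeneous (w1 d) q n) :
    eval (ept x) (∑ i, C (x i) * pderiv (Sum.inl i) q) = n * eval (ept x) q := by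
  have := congrArg (eval (ept x)) hq.sum_weight_X_mul_pderiv
  simp [w1, ept, Fintype.sum_sum_type] at this
  simp [ept, this]

lemma euler2 (x : Fin d → ℂ) (q : PP d) (n : ℕ) (hq : IsWeightedHomogeneous (w2 d) q n) :
    eval (ept x) (∑ i, C ((starRingEnd ℂ) (x i)) * pderiv (Sum.inr i) q)
      = n * eval (ept x) q := by
  have := congrArg (eval (ept x)) hq.sum_weight_X_mul_pderiv
  simp [w2, ept, Fintype.sum_sum_type] at this
  simp [ept, this]

lemma fis_one (q : PP d) : fis 1 q = coeff 0 q := by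
  rw [fis_eq_of_subset 1 q {0}]
  · simp [fw]
  · intro a ha
    rw [MvPolynomial.mem_support_iff, coeff_one] at ha
    simp at ha ⊢
    exact ha.symm

lemma repro0 (x : Fin d → ℂ) (q : PP d) (h1 : IsWeightedHomogeneous (w1 d) q 0)
    (h2 : IsWeightedHomogeneous (w2 d) q 0) : eval (ept x) q = coeff 0 q := by
  have : q = C (coeff 0 q) := by
    ext a
    rw [coeff_C]
    split_ifs with h
    · rw [h]
    · by_contra hne
      apply h
      have e1 := h1 hne
      have e2 := h2 hne
      rw [Finsupp.weight_apply, Finsupp.sum_fintype _ _ (by simp)] at e1 e2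
      simp [w1, w2, Fintype.sum_sum_type] at e1 e2
      ext i
      rcases i with i | i
      · simp [e1 i]
      · simp [e2 i]
  conv_lhs => rw [this]
  simp

lemma repro2 (x : Fin d → ℂ) (l : ℕ) : ∀ (q : PP d), IsWeightedHomogeneous (w1 d) q 0 →
    IsWeightedHomogeneous (w2 d) q l →
    fis (fB x ^ l) q = (l.factorial : ℂ) * eval (ept x) q := by
  induction l with
  | zero => intro q h1 h2; simp [fis_one, repro0 x q h1 h2]
  | succ l ih =>
    intro q h1 h2
    rw [pow_succ', fis_fB_mul, ih, euler2 x q _ h2, Nat.factorial_succ]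
    · push_cast; ring
    · refine IsWeightedHomogeneous.sum _ _ _ fun i _ => ?_
      exact (isWH_pderiv _ q 0 0 _ h1 (by simp [w1])).C_mul _
    · refine IsWeightedHomogeneous.sum _ _ _ fun i _ => ?_
      exact (isWH_pderiv _ q _ l _ h2 (by simp [w2])).C_mul _

lemma repro (x : Fin d → ℂ) (k l : ℕ) : ∀ (q : PP d), IsWeightedHomogeneous (w1 d) q k →
    IsWeightedHomogeneous (w2 d) q l →
    fis (fA x ^ k * fB x ^ l) q
      = (k.factorial : ℂ) * (l.factorial : ℂ) * eval (ept x) q := by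
  induction k with
  | zero => intro q h1 h2; simp [repro2 x l q h1 h2]
  | succ k ih =>
    intro q h1 h2
    rw [pow_succ', mul_assoc, fis_fA_mul, ih, euler1 x q _ h1, Nat.factorial_succ]
    · push_cast; ring
    · refine IsWeightedHomogeneous.sum _ _ _ fun i _ => ?_
      exact (isWH_pderiv _ q _ k _ h1 (by simp [w1])).C_mul _
    · refine IsWeightedHomogeneous.sum _ _ _ fun i _ => ?_
      exact (isWH_pderiv _ q _ l _ h2 (by simp [w2])).C_mul _

lemma fA_w1 (x : Fin d → ℂ) : IsWeightedHomogeneous (w1 d) (fA x) 1 :=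
  IsWeightedHomogeneous.sum _ _ _ fun i _ => (isWeightedHomogeneous_X ℂ (w1 d) (Sum.inl i)).C_mul _
lemma fA_w2 (x : Fin d → ℂ) : IsWeightedHomogeneous (w2 d) (fA x) 0 :=
  IsWeightedHomogeneous.sum _ _ _ fun i _ => (isWeightedHomogeneous_X ℂ (w2 d) (Sum.inl i)).C_mul _
lemma fB_w1 (x : Fin d → ℂ) : IsWeightedHomogeneous (w1 d) (fB x) 0 :=
  IsWeightedHomogeneous.sum _ _ _ fun i _ => (isWeightedHomogeneous_X ℂ (w1 d) (Sum.inr i)).C_mul _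
lemma fB_w2 (x : Fin d → ℂ) : IsWeightedHomogeneous (w2 d) (fB x) 1 :=
  IsWeightedHomogeneous.sum _ _ _ fun i _ => (isWeightedHomogeneous_X ℂ (w2 d) (Sum.inr i)).C_mul _
lemma fN_w1 : IsWeightedHomogeneous (w1 d) (fN d) 1 :=
  IsWeightedHomogeneous.sum _ _ _ fun i _ => (isWeightedHomogeneous_X ℂ (w1 d) (Sum.inl i)).mul
    (isWeightedHomogeneous_X ℂ (w1 d) (Sum.inr i))
lemma fN_w2 : IsWeightedHomogeneous (w2 d) (fN d) 1 :=
  IsWeightedHomogeneous.sum _ _ _ fun i _ => (isWeightedHomogeneous_X ℂ (w2 d) (Sum.inl i)).mul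
    (isWeightedHomogeneous_X ℂ (w2 d) (Sum.inr i))

lemma term_w1 (x : Fin d → ℂ) (r a b : ℕ) :
    IsWeightedHomogeneous (w1 d) (fN d ^ r * (fA x ^ a * fB x ^ b)) (r + a) := by
  have := (fN_w1 (d := d)).pow r |>.mul (((fA_w1 x).pow a).mul ((fB_w1 x).pow b))
  simpa using this

lemma term_w2 (x : Fin d → ℂ) (r a b : ℕ) :
    IsWeightedHomogeneous (w2 d) (fN d ^ r * (fA x ^ a * fB x ^ b)) (r + b) := by
  have := (fN_w2 (d := d)).pow r |>.mul (((fA_w2 x).pow a).mul ((fB_w2 x).pow b))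
  simpa using this

lemma dl_A (x : Fin d → ℂ) (i : Fin d) :
    pderiv (Sum.inl i) (fA x) = C ((starRingEnd ℂ) (x i)) := by
  simp [fA, pderiv_X, Pi.single_apply]
lemma dr_A (x : Fin d → ℂ) (i : Fin d) : pderiv (Sum.inr i) (fA x) = 0 := by
  simp [fA, pderiv_X, Pi.single_apply]
lemma dl_B (x : Fin d → ℂ) (i : Fin d) : pderiv (Sum.inl i) (fB x) = 0 := by
  simp [fB, pderiv_X, Pi.single_apply]
lemma dr_B (x : Fin d → ℂ) (i : Fin d) : pderiv (Sum.inr i) (fB x) = C (x i) := by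
  simp [fB, pderiv_X, Pi.single_apply]
lemma dl_N (i : Fin d) : pderiv (Sum.inl i) (fN d) = X (Sum.inr i) := by
  simp [fN, pderiv_X, Pi.single_apply]
lemma dr_N (i : Fin d) : pderiv (Sum.inr i) (fN d) = X (Sum.inl i) := by
  simp [fN, pderiv_X, Pi.single_apply]

/-- Laplacian of the basic terms. -/
lemma lap_term (x : Fin d → ℂ) (hx : cInner x x = 1) (r a b : ℕ) :
    lap (fN d ^ r * (fA x ^ a * fB x ^ b))
      = C ((r : ℂ) * (r - 1 + d + a + b)) * (fN d ^ (r - 1) * (fA x ^ a * fB x ^ b))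
        + C ((a : ℂ) * b) * (fN d ^ r * (fA x ^ (a - 1) * fB x ^ (b - 1))) := by
  have key : ∀ i : Fin d, pderiv (Sum.inl i) (pderiv (Sum.inr i)
      (fN d ^ r * (fA x ^ a * fB x ^ b))) =
      ((r : PP d) * ((r - 1 : ℕ) : PP d) * fN d ^ (r - 1 - 1) * (fA x ^ a * fB x ^ b))
          * (X (Sum.inl i) * X (Sum.inr i))
        + (r : PP d) * fN d ^ (r - 1) * (fA x ^ a * fB x ^ b)
        + ((r : PP d) * (a : PP d) * fN d ^ (r - 1) * fA x ^ (a - 1) * fB x ^ b)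
          * (C ((starRingEnd ℂ) (x i)) * X (Sum.inl i))
        + ((r : PP d) * (b : PP d) * fN d ^ (r - 1) * fA x ^ a * fB x ^ (b - 1))
          * (C (x i) * X (Sum.inr i))
        + ((a : PP d) * (b : PP d) * fN d ^ r * fA x ^ (a - 1) * fB x ^ (b - 1))
          * C ((starRingEnd ℂ) (x i) * x i) := by
    intro i
    have hn : ∀ n : ℕ, pderiv (Sum.inl i) (n : PP d) = 0 := fun n => by
      simp
    simp only [pderiv_mul, pderiv_pow, dl_A, dr_A, dl_B, dr_B, dl_N, dr_N, map_add, hn,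
      pderiv_X_self, pderiv_C, map_zero, mul_zero, zero_mul, add_zero, zero_add, C_mul]
    ring
  unfold lap
  rw [Finset.sum_congr rfl fun i _ => key i]
  simp only [Finset.sum_add_distrib, ← Finset.mul_sum]
  have hN : ∑ i, X (Sum.inl i) * X (Sum.inr i) = fN d := rfl
  have hA : ∑ i, C ((starRingEnd ℂ) (x i)) * X (Sum.inl i) = fA x := rfl
  have hB : ∑ i, C (x i) * X (Sum.inr i) = fB x := rfl
  have h1 : ∑ i, (C ((starRingEnd ℂ) (x i) * x i) : PP d) = 1 := by
    rw [← map_sum]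
    have : ∑ i, (starRingEnd ℂ) (x i) * x i = 1 := hx
    rw [this, C_1]
  rw [hN, hA, hB, h1]
  simp only [Finset.sum_const, Finset.card_univ, Fintype.card_fin, nsmul_eq_mul, C_mul, C_add,
    C_sub, C_1, map_natCast]
  have eA : (a : PP d) * fA x ^ (a - 1) * fA x = a * fA x ^ a := by
    rcases a with _ | a
    · simp
    · simp [pow_succ]; ring
  have eB : (b : PP d) * fB x ^ (b - 1) * fB x = b * fB x ^ b := by
    rcases b with _ | b
    · simp
    · simp [pow_succ]; ring
  have eN : (r : PP d) * ((r - 1 : ℕ) : PP d) * fN d ^ (r - 1 - 1) * fN d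
      = r * (r - 1) * fN d ^ (r - 1) := by
    rcases r with _ | _ | r
    · simp
    · simp
    · simp [pow_succ]; ring
  linear_combination (fA x ^ a * fB x ^ b) * eN + (r : PP d) * fN d ^ (r - 1) * fB x ^ b * eA
    + (r : PP d) * fN d ^ (r - 1) * fA x ^ a * eB

/-- coefficients -/
noncomputable def cc (d k l r : ℕ) : ℂ :=
  ((-1 : ℂ) ^ r * (Nat.factorial (d + k + l - r - 2) : ℂ)) /
          ((Nat.factorial r : ℂ) * (Nat.factorial (k - r) : ℂ) *
            (Nat.factorial (l - r) : ℂ))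

/-- zonal harmonic -/
noncomputable def HH (k l : ℕ) (x : Fin d → ℂ) : PP d :=
  ∑ r ∈ Finset.range (min k l + 1),
    C (cc d k l r) * (fN d ^ r * (fA x ^ (k - r) * fB x ^ (l - r)))

lemma lap_sum {ι : Type} (s : Finset ι) (c : ι → ℂ) (q : ι → PP d) :
    lap (∑ i ∈ s, C (c i) * q i) = ∑ i ∈ s, C (c i) * lap (q i) := by
  unfold lap
  simp only [map_sum, pderiv_C_mul, Finset.mul_sum]
  rw [Finset.sum_comm]

lemma cc_rec (hd : 2 ≤ d) (k l r : ℕ) (hr : r < min k l) :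
    cc d k l (r + 1) * (((r + 1 : ℕ) : ℂ) * (((r + 1 : ℕ) : ℂ) - 1 + d + (k - (r + 1) : ℕ)
      + (l - (r + 1) : ℕ))) + cc d k l r * (((k - r : ℕ) : ℂ) * (l - r : ℕ)) = 0 := by
  obtain ⟨a, rfl⟩ : ∃ a, k = r + 1 + a := ⟨k - (r + 1), by omega⟩
  obtain ⟨b, rfl⟩ : ∃ b, l = r + 1 + b := ⟨l - (r + 1), by omega⟩
  obtain ⟨e, rfl⟩ : ∃ e, d = e + 2 := ⟨d - 2, by omega⟩
  have h1 : e + 2 + (r + 1 + a) + (r + 1 + b) - (r + 1) - 2 = e + a + b + r + 1 - 0 := by omega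
  have h2 : e + 2 + (r + 1 + a) + (r + 1 + b) - r - 2 = (e + a + b + r + 1) + 1 := by omega
  have h3 : r + 1 + a - (r + 1) = a := by omega
  have h4 : r + 1 + b - (r + 1) = b := by omega
  have h5 : r + 1 + a - r = a + 1 := by omega
  have h6 : r + 1 + b - r = b + 1 := by omega
  unfold cc
  rw [h1, h2, h3, h4, h5, h6, Nat.sub_zero, Nat.factorial_succ (e + a + b + r + 1),
    Nat.factorial_succ r, Nat.factorial_succ a, Nat.factorial_succ b]
  have f1 : (r.factorial : ℂ) ≠ 0 := by exact_mod_cast r.factorial_ne_zero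
  have f2 : (a.factorial : ℂ) ≠ 0 := by exact_mod_cast a.factorial_ne_zero
  have f3 : (b.factorial : ℂ) ≠ 0 := by exact_mod_cast b.factorial_ne_zero
  have g1 : (r : ℂ) + 1 ≠ 0 := by exact_mod_cast r.succ_ne_zero
  have g2 : (a : ℂ) + 1 ≠ 0 := by exact_mod_cast a.succ_ne_zero
  have g3 : (b : ℂ) + 1 ≠ 0 := by exact_mod_cast b.succ_ne_zero
  push_cast
  field_simp
  ring

lemma lap_HH (hd : 2 ≤ d) (k l : ℕ) (x : Fin d → ℂ) (hx : cInner x x = 1) :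
    lap (HH k l x) = 0 := by
  unfold HH
  have hc : ∀ (u v w : ℂ) (p q : PP d), C u * (C v * p + C w * q)
      = C (u * v) * p + C (u * w) * q := by
    intro u v w p q
    rw [C_mul, C_mul]; ring
  rw [lap_sum]
  simp only [lap_term x hx, hc]
  rw [Finset.sum_add_distrib, Finset.sum_range_succ']
  rw [Finset.sum_range_succ _ (min k l)]
  have e0 : ((k - min k l : ℕ) : ℂ) * (l - min k l : ℕ) = 0 := by
    rcases le_total k l with h | h <;> simp [h]
  rw [e0]
  simp only [Nat.cast_zero, zero_mul, mul_zero, map_zero, add_zero]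
  rw [← Finset.sum_add_distrib]
  refine Finset.sum_eq_zero fun r hr => ?_
  have := cc_rec hd k l r (Finset.mem_range.1 hr)
  rw [Nat.add_sub_cancel, Nat.sub_sub k, Nat.sub_sub l, ← add_mul, ← C_add, this]
  simp

lemma HH_w1 (k l : ℕ) (x : Fin d → ℂ) : IsWeightedHomogeneous (w1 d) (HH k l x) k := by
  refine IsWeightedHomogeneous.sum _ _ _ fun r hr => ?_
  have := (term_w1 x r (k - r) (l - r)).C_mul (cc d k l r)
  rw [Finset.mem_range] at hr
  rwa [show r + (k - r) = k by omega] at this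

lemma HH_w2 (k l : ℕ) (x : Fin d → ℂ) : IsWeightedHomogeneous (w2 d) (HH k l x) l := by
  refine IsWeightedHomogeneous.sum _ _ _ fun r hr => ?_
  have := (term_w2 x r (k - r) (l - r)).C_mul (cc d k l r)
  rw [Finset.mem_range] at hr
  rwa [show r + (l - r) = l by omega] at this

lemma conj_cInner (x y : Fin d → ℂ) : (starRingEnd ℂ) (cInner x y) = cInner y x := by
  simp [cInner, mul_comm]

lemma eval_HH (k l : ℕ) (x y : Fin d → ℂ) (hx : cInner x x = 1) :
    eval (ept x) (HH k l y) = ∑ r ∈ Finset.range (min k l + 1),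
      cc d k l r * cInner y x ^ (k - r) * ((starRingEnd ℂ) (cInner y x)) ^ (l - r) := by
  have hN : eval (ept x) (fN d) = 1 := by
    rw [← hx]; simp [fN, ept, cInner, mul_comm]
  have hA : eval (ept x) (fA y) = cInner y x := by simp [fA, ept, cInner]
  have hB : eval (ept x) (fB y) = (starRingEnd ℂ) (cInner y x) := by
    rw [conj_cInner]; simp [fB, ept, cInner, mul_comm]
  unfold HH
  simp [hN, hA, hB, mul_assoc]

lemma fis_HH (hd : 2 ≤ d) (k l : ℕ) (x y : Fin d → ℂ) (hy : cInner y y = 1) :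
    fis (HH k l x) (HH k l y)
      = (Nat.factorial (d + k + l - 2) : ℂ) * eval (ept x) (HH k l y) := by
  conv_lhs => rw [HH]
  rw [fis_sum_left, Finset.sum_range_succ', Finset.sum_eq_zero, zero_add]
  · rw [fis_C_mul_left, pow_zero, one_mul, Nat.sub_zero, Nat.sub_zero,
      repro x k l _ (HH_w1 k l y) (HH_w2 k l y)]
    have f2 : (k.factorial : ℂ) ≠ 0 := by exact_mod_cast k.factorial_ne_zero
    have f3 : (l.factorial : ℂ) ≠ 0 := by exact_mod_cast l.factorial_ne_zero
    simp [cc]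
    field_simp
  · intro r _
    rw [fis_C_mul_left, pow_succ', mul_assoc, fis_fN_mul, lap_HH hd k l y hy, fis_zero_right,
      mul_zero]

lemma jacobi_eq (k l : ℕ) (x y : Fin d → ℂ) (hx : cInner x x = 1) :
    jacobi d k l (cInner y x) = (((d + k + l - 1 : ℕ) : ℂ) / (Nat.factorial (d - 1) : ℂ)) *
      eval (ept x) (HH k l y) := by
  rw [eval_HH k l x y hx]; rfl

/-- positive definiteness -/
lemma jacobi_posdef (hd : 2 ≤ d) (k l : ℕ) (S : Finset (Fin d → ℂ))
    (hS : ∀ x ∈ S, cInner x x = 1) :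
    0 ≤ (∑ x ∈ S, ∑ y ∈ S, jacobi d k l (cInner x y)).re := by
  have e : ∑ x ∈ S, ∑ y ∈ S, jacobi d k l (cInner x y)
      = (((((d + k + l - 1 : ℕ) : ℝ) / (Nat.factorial (d - 1) : ℝ)) /
        (Nat.factorial (d + k + l - 2) : ℝ) : ℝ) : ℂ) *
        fis (∑ x ∈ S, HH k l x) (∑ x ∈ S, HH k l x) := by
    rw [fis_sum_left, Finset.sum_comm, Finset.mul_sum]
    refine Finset.sum_congr rfl fun x hx => ?_
    rw [fis_sum_right, Finset.mul_sum]
    refine Finset.sum_congr rfl fun y hy => ?_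
    rw [jacobi_eq k l x y (hS x hx), fis_HH hd k l x y (hS y hy)]
    have f : ((d + k + l - 2).factorial : ℂ) ≠ 0 := by exact_mod_cast Nat.factorial_ne_zero _
    push_cast
    field_simp
  rw [e, Complex.re_ofReal_mul]
  exact mul_nonneg (by positivity) (fis_self_nonneg _)

/-! ### Moments of designs -/

lemma moment (x : Fin d → ℂ) (hx : cInner x x = 1) (T : Finset (ℕ × ℕ))
    (S : Finset (Fin d → ℂ)) (hdes : IsDesign d S T) (k l : ℕ) (hkl : (k, l) ∈ T) :
    ∑ y ∈ S, cInner x y ^ k * ((starRingEnd ℂ) (cInner x y)) ^ l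
      = if k = l then (S.card : ℂ) * ((Nat.factorial k : ℂ) * (Nat.factorial (d - 1) : ℂ) /
        (Nat.factorial (d + k - 1) : ℂ)) else 0 := by
  have h1 : ∀ y ∈ S, cInner x y ^ k * ((starRingEnd ℂ) (cInner x y)) ^ l =
      ∑ a ∈ piAntidiag univ k, ∑ b ∈ piAntidiag univ l,
        ((Nat.multinomial univ a : ℂ) * (Nat.multinomial univ b : ℂ) *
          (∏ i, ((starRingEnd ℂ) (x i)) ^ a i) * (∏ i, (x i) ^ b i)) *
          ((∏ i, (y i) ^ (a i)) * ∏ i, ((starRingEnd ℂ) (y i)) ^ (b i)) := by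
    intro y _
    rw [conj_cInner]
    unfold cInner
    rw [Finset.sum_pow_eq_sum_piAntidiag, Finset.sum_pow_eq_sum_piAntidiag, Finset.sum_mul_sum]
    refine Finset.sum_congr rfl fun a _ => Finset.sum_congr rfl fun b _ => ?_
    simp only [mul_pow, Finset.prod_mul_distrib]
    ring
  rw [Finset.sum_congr rfl h1, Finset.sum_comm]
  have h2 : ∀ a ∈ piAntidiag (univ : Finset (Fin d)) k,
      ∑ y ∈ S, ∑ b ∈ piAntidiag univ l,
        ((Nat.multinomial univ a : ℂ) * (Nat.multinomial univ b : ℂ) *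
          (∏ i, ((starRingEnd ℂ) (x i)) ^ a i) * (∏ i, (x i) ^ b i)) *
          ((∏ i, (y i) ^ (a i)) * ∏ i, ((starRingEnd ℂ) (y i)) ^ (b i))
      = ∑ b ∈ piAntidiag univ l,
        ((Nat.multinomial univ a : ℂ) * (Nat.multinomial univ b : ℂ) *
          (∏ i, ((starRingEnd ℂ) (x i)) ^ a i) * (∏ i, (x i) ^ b i)) *
          ((S.card : ℂ) * monomialAvg d a b) := by
    intro a ha
    rw [Finset.sum_comm]
    refine Finset.sum_congr rfl fun b hb => ?_
    rw [← Finset.mul_sum]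
    rw [Finset.mem_piAntidiag] at ha hb
    rw [hdes (k, l) hkl a b ha.1 hb.1]
  rw [Finset.sum_congr rfl h2]
  split_ifs with h
  · subst h
    have h3 : ∀ a ∈ piAntidiag (univ : Finset (Fin d)) k,
      ∑ b ∈ piAntidiag univ k,
        ((Nat.multinomial univ a : ℂ) * (Nat.multinomial univ b : ℂ) *
          (∏ i, ((starRingEnd ℂ) (x i)) ^ a i) * (∏ i, (x i) ^ b i)) *
          ((S.card : ℂ) * monomialAvg d a b) =
        ((Nat.multinomial univ a : ℂ) * ∏ i, ((starRingEnd ℂ) (x i) * x i) ^ a i) *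
        ((S.card : ℂ) * ((Nat.factorial k : ℂ) * (Nat.factorial (d - 1) : ℂ) /
          (Nat.factorial (d + k - 1) : ℂ))) := by
      intro a ha
      rw [Finset.sum_eq_single_of_mem a ha]
      · have hs := Nat.multinomial_spec univ a
        rw [Finset.mem_piAntidiag] at ha
        rw [ha.1] at hs
        unfold monomialAvg
        rw [if_pos rfl, ha.1, ← hs]
        simp only [mul_pow, Finset.prod_mul_distrib]
        push_cast
        ring
      · intro b _ hb
        simp [monomialAvg, hb.symm]
    rw [Finset.sum_congr rfl h3, ← Finset.sum_mul, ← Finset.sum_pow_eq_sum_piAntidiag]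
    have : ∑ i, (starRingEnd ℂ) (x i) * x i = 1 := hx
    rw [this, one_pow, one_mul]
  · refine Finset.sum_eq_zero fun a ha => Finset.sum_eq_zero fun b hb => ?_
    rw [Finset.mem_piAntidiag] at ha hb
    have : a ≠ b := by
      rintro rfl
      exact h (ha.1.symm.trans hb.1)
    simp [monomialAvg, this]

lemma alt_sum (m k : ℕ) :
    ∑ s ∈ Finset.range (k + 1 + 1), (-1 : ℤ) ^ (k + 1 - s) * ((k + 1).choose s : ℤ) *
      ((m + s).choose k : ℤ) = 0 := by
  have h := fwdDiff_iter_eq_sum_shift 1 (fun x ↦ (x.choose k : ℤ)) (k + 1) m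
  have h0 : (fwdDiff 1)^[k + 1] (fun x ↦ (x.choose k : ℤ)) m = 0 := by
    rw [Function.iterate_succ_apply']
    have := fwdDiff_iter_choose 0 k
    rw [add_zero] at this
    rw [this]
    simp
  rw [h0] at h
  simpa using h.symm

lemma alt_sum' (hd : 2 ≤ d) (k : ℕ) (hk : k ≠ 0) :
    ∑ r ∈ Finset.range (k + 1), cc d k k r *
      ((Nat.factorial (k - r) : ℂ) * (Nat.factorial (d - 1) : ℂ) /
        (Nat.factorial (d + (k - r) - 1) : ℂ)) = 0 := by
  obtain ⟨k, rfl⟩ := Nat.exists_eq_succ_of_ne_zero hk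
  obtain ⟨e, rfl⟩ : ∃ e, d = e + 2 := ⟨d - 2, by omega⟩
  rw [← Finset.sum_flip]
  have h := congrArg (fun z : ℤ => (z : ℂ)) (alt_sum (e + k + 1) k)
  simp only [Int.cast_zero] at h
  rw [← mul_zero ((Nat.factorial (e + 1) : ℂ) * (Nat.factorial k : ℂ) /
    (Nat.factorial (k + 1) : ℂ)), ← h]
  push_cast
  rw [Finset.mul_sum]
  refine Finset.sum_congr rfl fun s hs => ?_
  rw [Finset.mem_range] at hs
  have hsk : s ≤ k + 1 := by omega
  have c1 : ((k + 1).choose s : ℂ) = (Nat.factorial (k + 1) : ℂ) /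
      ((Nat.factorial s : ℂ) * (Nat.factorial (k + 1 - s) : ℂ)) := Nat.cast_choose ℂ hsk
  have c2 : ((e + k + 1 + s).choose k : ℂ) = (Nat.factorial (e + k + 1 + s) : ℂ) /
      ((Nat.factorial k : ℂ) * (Nat.factorial (e + k + 1 + s - k) : ℂ)) :=
    Nat.cast_choose ℂ (by omega)
  have e1 : e + k + 1 + s - k = e + s + 1 := by omega
  have e2 : k.succ - (k.succ - s) = s := by omega
  have e3 : e + 2 + k.succ + k.succ - (k.succ - s) - 2 = e + k + 1 + s := by omega
  have e4 : e + 2 + s - 1 = e + s + 1 := by omega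
  rw [c1, c2, e1]
  unfold cc
  rw [e2, e3, e4]
  have f (n : ℕ) : (n.factorial : ℂ) ≠ 0 := by exact_mod_cast n.factorial_ne_zero
  have f1 := f s
  have f2 := f (k + 1 - s)
  have f3 := f k
  have f4 := f (k + 1)
  have f5 := f (e + s + 1)
  field_simp

lemma jacobi_design (hd : 2 ≤ d) (T : Finset (ℕ × ℕ)) (hT : IsLowerSet' T)
    (S : Finset (Fin d → ℂ)) (hdes : IsDesign d S T) (k l : ℕ) (hkl : (k, l) ∈ T)
    (h0 : (k, l) ≠ (0, 0)) (x : Fin d → ℂ) (hx : cInner x x = 1) :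
    ∑ y ∈ S, jacobi d k l (cInner x y) = 0 := by
  have e : ∑ y ∈ S, jacobi d k l (cInner x y)
      = (((d + k + l - 1 : ℕ) : ℂ) / (Nat.factorial (d - 1) : ℂ)) *
        ∑ r ∈ Finset.range (min k l + 1), cc d k l r *
          ∑ y ∈ S, cInner x y ^ (k - r) * ((starRingEnd ℂ) (cInner x y)) ^ (l - r) := by
    unfold jacobi
    rw [← Finset.mul_sum, Finset.sum_comm]
    congr 1
    refine Finset.sum_congr rfl fun r _ => ?_
    rw [Finset.mul_sum]
    refine Finset.sum_congr rfl fun y _ => ?_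
    rw [cc]; ring
  have hm : ∀ r, (k - r, l - r) ∈ T := fun r => hT (k, l) hkl _ (Nat.sub_le _ _) (Nat.sub_le _ _)
  rw [e]
  simp only [moment x hx T S hdes _ _ (hm _)]
  by_cases h : k = l
  · subst h
    have hk : k ≠ 0 := by rintro rfl; exact h0 rfl
    have := alt_sum' hd k hk
    simp only [if_true, min_self]
    have h2 : ∀ r ∈ Finset.range (k + 1), cc d k k r * ((S.card : ℂ) *
        ((Nat.factorial (k - r) : ℂ) * (Nat.factorial (d - 1) : ℂ) /
          (Nat.factorial (d + (k - r) - 1) : ℂ))) = (S.card : ℂ) * (cc d k k r *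
        ((Nat.factorial (k - r) : ℂ) * (Nat.factorial (d - 1) : ℂ) /
          (Nat.factorial (d + (k - r) - 1) : ℂ))) := fun r _ => by ring
    rw [Finset.sum_congr rfl h2, ← Finset.mul_sum, this]
    simp
  · rw [Finset.sum_eq_zero, mul_zero]
    intro r hr
    rw [Finset.mem_range] at hr
    rw [if_neg (by omega), mul_zero]

lemma jacobi_zero (hd : 2 ≤ d) (x : ℂ) : jacobi d 0 0 x = 1 := by
  obtain ⟨e, rfl⟩ : ∃ e, d = e + 2 := ⟨d - 2, by omega⟩
  have f : (e.factorial : ℂ) ≠ 0 := by exact_mod_cast e.factorial_ne_zero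
  have g : (e : ℂ) + 1 ≠ 0 := by exact_mod_cast e.succ_ne_zero
  simp [jacobi, Nat.factorial_succ]
  field_simp

end LP

open scoped Classical

/-- LP lower bound: if `X` is a `T`-design, `f₀₀ > 0`,
`f_{k,l} ≤ 0` off `T`, and `F = ∑ f_{k,l} g_{k,l}` is nonnegative on `A(X)`,
then `|X| ≥ F(1)/f₀₀`. -/
theorem stmt_10 {d : ℕ} (hd : 2 ≤ d) (T : Finset (ℕ × ℕ)) (hT : IsLowerSet' T)
    (X : Finset (Fin d → ℂ)) (hXne : X.Nonempty)
    (hXsphere : ∀ x ∈ X, cInner x x = 1)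
    (hdesign : IsDesign d X T)
    (f : (ℕ × ℕ) →₀ ℝ) (hf0 : 0 < f (0, 0))
    (hfneg : ∀ kl : ℕ × ℕ, kl ∉ T → f kl ≤ 0)
    (hF : ∀ α ∈ innerSet X,
      (∑ kl ∈ f.support, (f kl : ℂ) * jacobi d kl.1 kl.2 α).im = 0 ∧
      0 ≤ (∑ kl ∈ f.support, (f kl : ℂ) * jacobi d kl.1 kl.2 α).re) :
    (∑ kl ∈ f.support, (f kl : ℂ) * jacobi d kl.1 kl.2 1).re / f (0, 0) ≤ (X.card : ℝ) := by
  have hsum : ∀ x ∈ X, ∀ y ∈ X, x ≠ y →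
      0 ≤ (∑ kl ∈ f.support, (f kl : ℂ) * jacobi d kl.1 kl.2 (cInner x y)).re := by
    intro x hx y hy hxy
    refine (hF _ ?_).2
    unfold innerSet
    rw [Finset.mem_image]
    exact ⟨(x, y), by simp [hx, hy, hxy], rfl⟩
  set F : ℂ → ℝ := fun α => (∑ kl ∈ f.support, (f kl : ℂ) * jacobi d kl.1 kl.2 α).re with hFdef
  have lower : (X.card : ℝ) * F 1 ≤ ∑ x ∈ X, ∑ y ∈ X, F (cInner x y) := by
    rw [← nsmul_eq_mul, ← Finset.sum_const]
    refine Finset.sum_le_sum fun x hx => ?_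
    rw [← hXsphere x hx]
    rw [← Finset.add_sum_erase _ _ hx]
    refine le_add_of_nonneg_right (Finset.sum_nonneg fun y hy => ?_)
    exact hsum x hx y (Finset.mem_of_mem_erase hy) (Finset.ne_of_mem_erase hy).symm
  have swap : ∑ x ∈ X, ∑ y ∈ X, F (cInner x y)
      = ∑ kl ∈ f.support, f kl * (∑ x ∈ X, ∑ y ∈ X, jacobi d kl.1 kl.2 (cInner x y)).re := by
    simp only [hFdef, Complex.re_sum, Complex.re_ofReal_mul, Finset.mul_sum]
    rw [Finset.sum_comm]
    rw [Finset.sum_congr rfl fun y _ => Finset.sum_comm, Finset.sum_comm]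
    exact Finset.sum_congr rfl fun kl _ => Finset.sum_comm
  have upper : ∑ x ∈ X, ∑ y ∈ X, F (cInner x y) ≤ f (0, 0) * (X.card : ℝ) ^ 2 := by
    rw [swap]
    have h00 : ((0, 0) : ℕ × ℕ) ∈ f.support := by simpa using hf0.ne'
    rw [← Finset.add_sum_erase _ _ h00]
    have e0 : (∑ x ∈ X, ∑ y ∈ X, jacobi d (0, 0).1 (0, 0).2 (cInner x y)).re
        = (X.card : ℝ) ^ 2 := by
      simp [LP.jacobi_zero hd, sq]
    rw [e0]
    have : ∑ kl ∈ f.support.erase (0, 0),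
        f kl * (∑ x ∈ X, ∑ y ∈ X, jacobi d kl.1 kl.2 (cInner x y)).re ≤ 0 := by
      refine Finset.sum_nonpos fun kl hkl => ?_
      by_cases hkT : kl ∈ T
      · rw [Finset.sum_eq_zero fun x hx => LP.jacobi_design hd T hT X hdesign kl.1 kl.2 hkT
          (Finset.ne_of_mem_erase hkl) x (hXsphere x hx)]
        simp
      · exact mul_nonpos_of_nonpos_of_nonneg (hfneg kl hkT)
          (LP.jacobi_posdef hd kl.1 kl.2 X hXsphere)
    linarith
  have hc : (0 : ℝ) < X.card := by exact_mod_cast hXne.card_pos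
  rw [div_le_iff₀ hf0]
  have := lower.trans upper
  change F 1 ≤ _
  nlinarith
end

section
/- Let d ≥ 2 and let X be a finite nonempty subset of Ω(d). Let f : ℕ×ℕ → ℝ be finitely supported with f_{k,l} ≥ 0 for all (k,l) and f_{0,0} > 0, and define F(x) = Σ_{(k,l)} f_{k,l}·g_{k,l}(x). If for every α ∈ A(X) the value F(α) is a nonpositive real number, then |X| ≤ F(1)/f_{0,0}. -/
open Finset

open scoped Classical

namespace LPB
open MvPolynomial

/-- Fischer bilinear form. -/
noncomputable def fis (σ : Type) [Fintype σ] :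
    MvPolynomial σ ℂ →ₗ[ℂ] MvPolynomial σ ℂ →ₗ[ℂ] ℂ :=
  (basisMonomials σ ℂ).constr ℂ (fun m => (∏ i, ((m i).factorial : ℂ)) • lcoeff ℂ m)

lemma fis_monomial {σ : Type} [Fintype σ] (m : σ →₀ ℕ) (a : ℂ) (q : MvPolynomial σ ℂ) :
    fis σ (monomial m a) q = a * (∏ i, ((m i).factorial : ℂ)) * coeff m q := by
  have h1 : fis σ (monomial m 1) = (∏ i, ((m i).factorial : ℂ)) • lcoeff ℂ m := by
    have := (basisMonomials σ ℂ).constr_basis ℂ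
      (fun m => (∏ i, ((m i).factorial : ℂ)) • lcoeff ℂ m) m
    rwa [coe_basisMonomials] at this
  have h2 : (monomial m a : MvPolynomial σ ℂ) = a • monomial m 1 := by
    rw [smul_monomial]; simp
  rw [h2, map_smul, LinearMap.smul_apply, h1]
  simp [mul_assoc]

lemma fis_X_mul {σ : Type} [Fintype σ] (i : σ) (p q : MvPolynomial σ ℂ) :
    fis σ (X i * p) q = fis σ p (pderiv i q) := by
  induction p using MvPolynomial.induction_on' with
  | add p q hp hq => simp [mul_add, hp, hq]
  | monomial m a =>
    have : (X i * monomial m a : MvPolynomial σ ℂ) = monomial (m + Finsupp.single i 1) a := by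
      rw [X, monomial_mul, add_comm, one_mul]
    rw [this, fis_monomial, fis_monomial, coeff_pderiv]
    have h : (∏ j, (((m + Finsupp.single i 1 : σ →₀ ℕ) j).factorial : ℂ))
        = (m i + 1) * ∏ j, ((m j).factorial : ℂ) := by
      rw [← Finset.mul_prod_erase Finset.univ _ (Finset.mem_univ i),
        ← Finset.mul_prod_erase Finset.univ (fun j => ((m j).factorial : ℂ)) (Finset.mem_univ i)]
      rw [Finset.prod_congr rfl (g := fun j => ((m j).factorial : ℂ))]
      · simp [Nat.factorial_succ]; ring
      · intro j hj
        have : j ≠ i := Finset.ne_of_mem_erase hj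
        simp [Finsupp.single_apply, this.symm]
    rw [h]; ring

lemma fis_self_nonneg {σ : Type} [Fintype σ] (p : MvPolynomial σ ℂ) :
    0 ≤ (fis σ (map (starRingEnd ℂ) p) p).re := by
  have h : map (starRingEnd ℂ) p
      = ∑ m ∈ p.support, monomial m ((starRingEnd ℂ) (coeff m p)) := by
    conv_lhs => rw [p.as_sum, map_sum]
    simp only [map_monomial]
  rw [h, map_sum, LinearMap.sum_apply, Complex.re_sum]
  refine Finset.sum_nonneg fun m _ => ?_
  rw [fis_monomial]
  have : (starRingEnd ℂ) (coeff m p) * (∏ i, ((m i).factorial : ℂ)) * coeff m p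
      = (((∏ i, ((m i).factorial : ℝ)) * Complex.normSq (coeff m p) : ℝ) : ℂ) := by
    push_cast; rw [Complex.normSq_eq_conj_mul_self]; ring
  rw [this, Complex.ofReal_re]
  exact mul_nonneg (Finset.prod_nonneg fun _ _ => by positivity) (Complex.normSq_nonneg _)

variable {d : ℕ}

noncomputable def LA (u : Fin d → ℂ) : MvPolynomial (Fin d ⊕ Fin d) ℂ :=
  ∑ i, C (u i) * X (Sum.inl i)
noncomputable def LB (u : Fin d → ℂ) : MvPolynomial (Fin d ⊕ Fin d) ℂ :=
  ∑ i, C (u i) * X (Sum.inr i)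
noncomputable def NN (d : ℕ) : MvPolynomial (Fin d ⊕ Fin d) ℂ :=
  ∑ i, X (Sum.inl i) * X (Sum.inr i)
noncomputable def lap (q : MvPolynomial (Fin d ⊕ Fin d) ℂ) : MvPolynomial (Fin d ⊕ Fin d) ℂ :=
  ∑ i, pderiv (Sum.inl i) (pderiv (Sum.inr i) q)

lemma fis_NN_mul (p q : MvPolynomial (Fin d ⊕ Fin d) ℂ) :
    fis _ (NN d * p) q = fis _ p (lap q) := by
  simp only [NN, lap, Finset.sum_mul, map_sum, LinearMap.sum_apply]
  refine Finset.sum_congr rfl fun i _ => ?_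
  rw [mul_comm (X (Sum.inl i)), mul_assoc, fis_X_mul, fis_X_mul]

lemma fis_LA_mul (u : Fin d → ℂ) (p q : MvPolynomial (Fin d ⊕ Fin d) ℂ) :
    fis _ (LA u * p) q = fis _ p (∑ i, C (u i) * pderiv (Sum.inl i) q) := by
  simp only [LA, Finset.sum_mul, map_sum, LinearMap.sum_apply]
  refine Finset.sum_congr rfl fun i _ => ?_
  rw [mul_assoc, C_mul', C_mul', map_smul, map_smul, LinearMap.smul_apply, fis_X_mul]

lemma fis_LB_mul (u : Fin d → ℂ) (p q : MvPolynomial (Fin d ⊕ Fin d) ℂ) :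
    fis _ (LB u * p) q = fis _ p (∑ i, C (u i) * pderiv (Sum.inr i) q) := by
  simp only [LB, Finset.sum_mul, map_sum, LinearMap.sum_apply]
  refine Finset.sum_congr rfl fun i _ => ?_
  rw [mul_assoc, C_mul', C_mul', map_smul, map_smul, LinearMap.smul_apply, fis_X_mul]

def w1 (d : ℕ) : Fin d ⊕ Fin d → ℕ := Sum.elim (fun _ => 1) (fun _ => 0)
def w2 (d : ℕ) : Fin d ⊕ Fin d → ℕ := Sum.elim (fun _ => 0) (fun _ => 1)

lemma fis_repr (u v : Fin d → ℂ) (k l : ℕ) (q : MvPolynomial (Fin d ⊕ Fin d) ℂ)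
    (h1 : q.IsWeightedHomogeneous (w1 d) k) (h2 : q.IsWeightedHomogeneous (w2 d) l) :
    fis _ (LA u ^ k * LB v ^ l) q
      = k.factorial * l.factorial * eval (Sum.elim u v) q := by
  induction k generalizing q with
  | succ k ih =>
    rw [pow_succ', mul_assoc, fis_LA_mul, ih]
    · have e := congrArg (eval (Sum.elim u v)) h1.sum_weight_X_mul_pderiv
      simp [w1, Fintype.sum_sum_type] at e
      simp [Nat.factorial_succ, e]; ring
    · refine IsWeightedHomogeneous.sum _ _ _ fun i _ => ?_
      exact (h1.pderiv (by simp [w1])).C_mul _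
    · refine IsWeightedHomogeneous.sum _ _ _ fun i _ => ?_
      exact (h2.pderiv (by simp [w2])).C_mul _
  | zero =>
    induction l generalizing q with
    | succ l ih =>
      rw [pow_succ', mul_left_comm, fis_LB_mul, ih]
      · have e := congrArg (eval (Sum.elim u v)) h2.sum_weight_X_mul_pderiv
        simp [w2, Fintype.sum_sum_type] at e
        simp [Nat.factorial_succ, e]; ring
      · refine IsWeightedHomogeneous.sum _ _ _ fun i _ => ?_
        exact (h1.pderiv (by simp [w1])).C_mul _
      · refine IsWeightedHomogeneous.sum _ _ _ fun i _ => ?_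
        exact (h2.pderiv (by simp [w2])).C_mul _
    | zero =>
      have hq : q = C (coeff 0 q) := by
        ext m
        rw [coeff_C]
        split_ifs with h
        · rw [h]
        · by_contra hm
          apply h
          have e1 := h1 hm
          have e2 := h2 hm
          simp [w1, w2, Finsupp.weight_apply, Finsupp.sum_fintype, Fintype.sum_sum_type] at e1 e2
          ext i
          rcases i with i | i
          · simp [e1 i]
          · simp [e2 i]
      have : (1 : MvPolynomial (Fin d ⊕ Fin d) ℂ) = monomial 0 1 := rfl
      rw [hq]
      simp only [pow_zero, mul_one]
      rw [this, fis_monomial]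
      simp

lemma pl_LA (u : Fin d → ℂ) (i : Fin d) : pderiv (Sum.inl i) (LA u) = C (u i) := by
  simp [LA, pderiv_X, Pi.single_apply]
lemma pr_LA (u : Fin d → ℂ) (i : Fin d) : pderiv (Sum.inr i) (LA u) = 0 := by
  simp [LA, pderiv_X, Pi.single_apply]
lemma pr_LB (u : Fin d → ℂ) (i : Fin d) : pderiv (Sum.inr i) (LB u) = C (u i) := by
  simp [LB, pderiv_X, Pi.single_apply]
lemma pl_LB (u : Fin d → ℂ) (i : Fin d) : pderiv (Sum.inl i) (LB u) = 0 := by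
  simp [LB, pderiv_X, Pi.single_apply]
lemma pl_NN (i : Fin d) : pderiv (Sum.inl i) (NN d) = X (Sum.inr i) := by
  simp [NN, pderiv_X, Pi.single_apply]
lemma pr_NN (i : Fin d) : pderiv (Sum.inr i) (NN d) = X (Sum.inl i) := by
  simp [NN, pderiv_X, Pi.single_apply]

lemma aux_pow (n : ℕ) (A : MvPolynomial (Fin d ⊕ Fin d) ℂ) :
    (n : MvPolynomial (Fin d ⊕ Fin d) ℂ) * A ^ (n - 1) * A = n * A ^ n := by
  cases n with
  | zero => simp
  | succ n => simp [pow_succ, mul_assoc]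

lemma lap_term (u v : Fin d → ℂ) (a b c : ℕ) :
    lap (LA u ^ a * LB v ^ b * NN d ^ c)
      = (C (∑ i, u i * v i) : MvPolynomial (Fin d ⊕ Fin d) ℂ) * ((a : MvPolynomial (Fin d ⊕ Fin d) ℂ) * b * (LA u ^ (a-1) * LB v ^ (b-1) * NN d ^ c))
        + ((c : MvPolynomial (Fin d ⊕ Fin d) ℂ) * (a + b + d + (c - 1)))
          * (LA u ^ a * LB v ^ b * NN d ^ (c-1)) := by
  have key : ∀ i, pderiv (Sum.inl i) (pderiv (Sum.inr i) (LA u ^ a * LB v ^ b * NN d ^ c))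
      = C (u i) * C (v i) * ((a : MvPolynomial (Fin d ⊕ Fin d) ℂ) * (b : MvPolynomial (Fin d ⊕ Fin d) ℂ) *
            (LA u ^ (a-1) * LB v ^ (b-1) * NN d ^ c))
        + (C (v i) * X (Sum.inr i)) *
            ((b : MvPolynomial (Fin d ⊕ Fin d) ℂ) * LB v ^ (b-1) * ((c : MvPolynomial (Fin d ⊕ Fin d) ℂ) * LA u ^ a * NN d ^ (c-1)))
        + (X (Sum.inl i) * X (Sum.inr i)) *
            ((c : MvPolynomial (Fin d ⊕ Fin d) ℂ) * (((c - 1 : ℕ) : MvPolynomial (Fin d ⊕ Fin d) ℂ) * NN d ^ (c-1-1)) * LA u ^ a * LB v ^ b)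
        + (c : MvPolynomial (Fin d ⊕ Fin d) ℂ) * LA u ^ a * LB v ^ b * NN d ^ (c-1)
        + (C (u i) * X (Sum.inl i)) *
            ((a : MvPolynomial (Fin d ⊕ Fin d) ℂ) * LA u ^ (a-1) * ((c : MvPolynomial (Fin d ⊕ Fin d) ℂ) * LB v ^ b * NN d ^ (c-1))) := by
    intro i
    have hc : ∀ n : ℕ, ∀ j, pderiv j (n : MvPolynomial (Fin d ⊕ Fin d) ℂ) = 0 := fun n j => by
      simp
    simp only [pderiv_mul, pderiv_pow, pl_LA, pr_LA, pl_LB, pr_LB, pl_NN, pr_NN, map_add,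
      pderiv_C, pderiv_X_self, hc, mul_zero, zero_mul, add_zero, zero_add]
    ring
  unfold lap
  rw [Finset.sum_congr rfl fun i _ => key i]
  simp only [Finset.sum_add_distrib, ← Finset.sum_mul]
  have e1 : ∑ i, C (v i) * X (Sum.inr i) = LB v := rfl
  have e2 : ∑ i, C (u i) * X (Sum.inl i) = LA u := rfl
  have e3 : ∑ i : Fin d, X (Sum.inl i) * X (Sum.inr i) = NN d := rfl
  rw [e1, e2, e3, map_sum]
  simp only [map_mul, Finset.sum_const, Finset.card_univ, Fintype.card_fin, nsmul_eq_mul]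
  have a1 := aux_pow a (LA u)
  have a2 := aux_pow b (LB v)
  have a3 := aux_pow (c-1) (NN d)
  have a4 : (c : MvPolynomial (Fin d ⊕ Fin d) ℂ) * ((c - 1 : ℕ) : MvPolynomial (Fin d ⊕ Fin d) ℂ)
      = c * (c - 1) := by
    cases c <;> simp
  linear_combination (c * LB v ^ b * NN d ^ (c-1)) * a1 + (c * LA u ^ a * NN d ^ (c-1)) * a2
    + (c * LA u ^ a * LB v ^ b) * a3 + LA u ^ a * LB v ^ b * NN d ^ (c-1) * a4

noncomputable def cf (d k l r : ℕ) : ℂ :=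
  ((-1 : ℂ) ^ r * (Nat.factorial (d + k + l - r - 2) : ℂ)) /
          ((Nat.factorial r : ℂ) * (Nat.factorial (k - r) : ℂ) * (Nat.factorial (l - r) : ℂ))

noncomputable def HH (k l : ℕ) (u v : Fin d → ℂ) : MvPolynomial (Fin d ⊕ Fin d) ℂ :=
  ∑ r ∈ Finset.range (min k l + 1), cf d k l r • (LA u ^ (k-r) * LB v ^ (l-r) * NN d ^ r)

lemma cf_rec (hd : 2 ≤ d) (k l r : ℕ) (hr : r < min k l) :
    cf d k l r * ((k - r : ℕ) * (l - r : ℕ))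
      + cf d k l (r+1) * (((r + 1 : ℕ) : ℂ) * ((k - (r+1) : ℕ) + (l - (r+1) : ℕ) + d + ((r+1 : ℕ) - 1)))
      = 0 := by
  obtain ⟨k, rfl⟩ : ∃ k', k = r + 1 + k' := ⟨k - (r+1), by omega⟩
  obtain ⟨l, rfl⟩ : ∃ k', l = r + 1 + k' := ⟨l - (r+1), by omega⟩
  obtain ⟨d, rfl⟩ : ∃ k', d = k' + 2 := ⟨d - 2, by omega⟩
  unfold cf
  have h1 : d + 2 + (r + 1 + k) + (r + 1 + l) - r - 2 = (d + k + l + r + 1) + 1 := by omega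
  have h2 : d + 2 + (r + 1 + k) + (r + 1 + l) - (r + 1) - 2 = d + k + l + r + 1 := by omega
  have h3 : r + 1 + k - r = k + 1 := by omega
  have h4 : r + 1 + l - r = l + 1 := by omega
  rw [h1, h2, h3, h4, Nat.add_sub_cancel_left, Nat.add_sub_cancel_left]
  simp only [Nat.factorial_succ (d + k + l + r + 1), Nat.factorial_succ k, Nat.factorial_succ l,
    Nat.factorial_succ r]
  have := Nat.cast_ne_zero (R := ℂ).2 (Nat.factorial_ne_zero k)
  have := Nat.cast_ne_zero (R := ℂ).2 (Nat.factorial_ne_zero l)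
  have := Nat.cast_ne_zero (R := ℂ).2 (Nat.factorial_ne_zero r)
  have := Nat.cast_add_one_ne_zero (R := ℂ) k
  have := Nat.cast_add_one_ne_zero (R := ℂ) l
  have := Nat.cast_add_one_ne_zero (R := ℂ) r
  push_cast
  field_simp
  ring

lemma lap_HH (hd : 2 ≤ d) (k l : ℕ) (u v : Fin d → ℂ) (huv : ∑ i, u i * v i = 1) :
    lap (HH k l u v) = 0 := by
  have hlin : lap (HH k l u v) = ∑ r ∈ Finset.range (min k l + 1),
      cf d k l r • lap (LA u ^ (k-r) * LB v ^ (l-r) * NN d ^ r) := by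
    simp only [lap, HH, map_sum, Derivation.map_smul, Finset.smul_sum]
    rw [Finset.sum_comm]
  rw [hlin]
  simp only [lap_term, huv, smul_add, Finset.sum_add_distrib]
  rw [Finset.sum_range_succ _ (min k l), Finset.sum_range_succ' _ (min k l)]
  have h0 : ((k - min k l : ℕ) : MvPolynomial (Fin d ⊕ Fin d) ℂ) * ((l - min k l : ℕ) : MvPolynomial (Fin d ⊕ Fin d) ℂ) = 0 := by
    rcases le_total k l with h | h <;> simp [h]
  rw [h0]
  simp only [map_one, one_mul, zero_mul, smul_zero, add_zero, Nat.cast_zero]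
  rw [← Finset.sum_add_distrib]
  refine Finset.sum_eq_zero fun r hr => ?_
  have hr := cf_rec hd k l r (Finset.mem_range.1 hr)
  have hr := congrArg (C (σ := Fin d ⊕ Fin d)) hr
  simp only [smul_eq_C_mul, map_add, map_mul, map_sub, map_natCast, map_one, map_zero] at hr ⊢
  simp only [Nat.sub_sub, Nat.add_sub_cancel]
  linear_combination (LA u ^ (k - (r+1)) * LB v ^ (l - (r+1)) * NN d ^ r) * hr

lemma LA_w1 (u : Fin d → ℂ) : (LA u).IsWeightedHomogeneous (w1 d) 1 :=
  IsWeightedHomogeneous.sum _ _ _ fun i _ => (isWeightedHomogeneous_X ℂ (w1 d) (Sum.inl i)).C_mul _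
lemma LA_w2 (u : Fin d → ℂ) : (LA u).IsWeightedHomogeneous (w2 d) 0 :=
  IsWeightedHomogeneous.sum _ _ _ fun i _ => (isWeightedHomogeneous_X ℂ (w2 d) (Sum.inl i)).C_mul _
lemma LB_w1 (u : Fin d → ℂ) : (LB u).IsWeightedHomogeneous (w1 d) 0 :=
  IsWeightedHomogeneous.sum _ _ _ fun i _ => (isWeightedHomogeneous_X ℂ (w1 d) (Sum.inr i)).C_mul _
lemma LB_w2 (u : Fin d → ℂ) : (LB u).IsWeightedHomogeneous (w2 d) 1 :=
  IsWeightedHomogeneous.sum _ _ _ fun i _ => (isWeightedHomogeneous_X ℂ (w2 d) (Sum.inr i)).C_mul _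
lemma NN_w1 : (NN d).IsWeightedHomogeneous (w1 d) 1 :=
  IsWeightedHomogeneous.sum _ _ _ fun i _ =>
    (isWeightedHomogeneous_X ℂ (w1 d) (Sum.inl i)).mul (isWeightedHomogeneous_X ℂ (w1 d) (Sum.inr i))
lemma NN_w2 : (NN d).IsWeightedHomogeneous (w2 d) 1 :=
  IsWeightedHomogeneous.sum _ _ _ fun i _ =>
    (isWeightedHomogeneous_X ℂ (w2 d) (Sum.inl i)).mul (isWeightedHomogeneous_X ℂ (w2 d) (Sum.inr i))

lemma HH_w1 (k l : ℕ) (u v : Fin d → ℂ) : (HH k l u v).IsWeightedHomogeneous (w1 d) k := by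
  refine IsWeightedHomogeneous.sum _ _ _ fun r hr => ?_
  rw [smul_eq_C_mul]
  refine IsWeightedHomogeneous.C_mul ?_ _
  have h := (((LA_w1 u).pow (k-r)).mul ((LB_w1 v).pow (l-r))).mul ((NN_w1 (d := d)).pow r)
  convert h using 1
  have := Finset.mem_range.1 hr
  simp; omega
lemma HH_w2 (k l : ℕ) (u v : Fin d → ℂ) : (HH k l u v).IsWeightedHomogeneous (w2 d) l := by
  refine IsWeightedHomogeneous.sum _ _ _ fun r hr => ?_
  rw [smul_eq_C_mul]
  refine IsWeightedHomogeneous.C_mul ?_ _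
  have h := (((LA_w2 u).pow (k-r)).mul ((LB_w2 v).pow (l-r))).mul ((NN_w2 (d := d)).pow r)
  convert h using 1
  have := Finset.mem_range.1 hr
  simp; omega

lemma fis_HH (hd : 2 ≤ d) (k l : ℕ) (u v s t : Fin d → ℂ) (hst : ∑ i, s i * t i = 1) :
    fis _ (HH k l u v) (HH k l s t)
      = cf d k l 0 * (k.factorial * l.factorial * eval (Sum.elim u v) (HH k l s t)) := by
  rw [← fis_repr u v k l _ (HH_w1 k l s t) (HH_w2 k l s t)]
  conv_lhs => rw [HH]
  rw [map_sum, LinearMap.sum_apply, Finset.sum_range_succ', Finset.sum_eq_zero]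
  · simp
  · intro r _
    rw [map_smul, LinearMap.smul_apply, pow_succ', mul_left_comm, fis_NN_mul, lap_HH hd k l s t hst]
    simp

lemma map_HH (k l : ℕ) (u v : Fin d → ℂ) :
    map (starRingEnd ℂ) (HH k l u v)
      = HH k l (fun i => (starRingEnd ℂ) (u i)) (fun i => (starRingEnd ℂ) (v i)) := by
  simp [HH, LA, LB, NN, smul_eq_C_mul, cf]

lemma eval_HH (k l : ℕ) (x y : Fin d → ℂ) (hx : cInner x x = 1) :
    eval (Sum.elim x (fun i => (starRingEnd ℂ) (x i))) (HH k l (fun i => (starRingEnd ℂ) (y i)) y)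
     = ∑ r ∈ Finset.range (min k l + 1),
        cf d k l r * cInner y x ^ (k-r) * (starRingEnd ℂ) (cInner y x) ^ (l-r) := by
  have hN : eval (Sum.elim x (fun i => (starRingEnd ℂ) (x i))) (NN d) = 1 := by
    rw [← hx]; simp [NN, cInner, mul_comm]
  simp only [HH, map_sum, smul_eval, map_mul, map_pow, hN]
  simp [LA, LB, cInner, mul_assoc]

lemma jacobi_psd (hd : 2 ≤ d) (X : Finset (Fin d → ℂ)) (hX : ∀ x ∈ X, cInner x x = 1) (k l : ℕ) :
    0 ≤ (∑ x ∈ X, ∑ y ∈ X, jacobi d k l (cInner y x)).re := by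
  have h := fis_self_nonneg (∑ y ∈ X, HH k l (fun i => (starRingEnd ℂ) (y i)) y)
  have e : fis _ (map (starRingEnd ℂ) (∑ y ∈ X, HH k l (fun i => (starRingEnd ℂ) (y i)) y))
      (∑ y ∈ X, HH k l (fun i => (starRingEnd ℂ) (y i)) y)
      = cf d k l 0 * (k.factorial * l.factorial) * ∑ x ∈ X, ∑ y ∈ X,
         ∑ r ∈ Finset.range (min k l + 1),
        cf d k l r * cInner y x ^ (k-r) * (starRingEnd ℂ) (cInner y x) ^ (l-r) := by
    rw [map_sum (MvPolynomial.map (starRingEnd ℂ)), map_sum (fis _), LinearMap.sum_apply, Finset.mul_sum]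
    refine Finset.sum_congr rfl fun x hx => ?_
    rw [map_sum, Finset.mul_sum]
    refine Finset.sum_congr rfl fun y hy => ?_
    rw [map_HH, fis_HH hd _ _ _ _ _ _ (hX y hy)]
    simp only [Complex.conj_conj]
    rw [eval_HH k l x y (hX x hx)]; ring
  have e2 : cf d k l 0 * (k.factorial * l.factorial) = ((Nat.factorial (d + k + l - 2) : ℝ) : ℂ) := by
    have := Nat.cast_ne_zero (R := ℂ).2 (Nat.factorial_ne_zero k)
    have := Nat.cast_ne_zero (R := ℂ).2 (Nat.factorial_ne_zero l)
    simp [cf]; field_simp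
  rw [e, e2, Complex.re_ofReal_mul] at h
  have h := nonneg_of_mul_nonneg_right h (by positivity)
  have e3 : ∑ x ∈ X, ∑ y ∈ X, jacobi d k l (cInner y x)
     = (((d + k + l - 1 : ℕ) : ℝ) / (Nat.factorial (d - 1) : ℝ) : ℝ) * ∑ x ∈ X, ∑ y ∈ X,
         ∑ r ∈ Finset.range (min k l + 1),
        cf d k l r * cInner y x ^ (k-r) * (starRingEnd ℂ) (cInner y x) ^ (l-r) := by
    simp only [jacobi, Finset.mul_sum, cf]
    push_cast
    rfl
  rw [e3, Complex.re_ofReal_mul]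
  positivity

lemma jacobi_zero (hd : 2 ≤ d) (z : ℂ) : jacobi d 0 0 z = 1 := by
  obtain ⟨d, rfl⟩ : ∃ k', d = k' + 2 := ⟨d - 2, by omega⟩
  have := Nat.cast_ne_zero (R := ℂ).2 (Nat.factorial_ne_zero d)
  have := Nat.cast_add_one_ne_zero (R := ℂ) d
  simp [jacobi, Nat.factorial_succ]
  field_simp

end LPB

/-- LP upper bound: if `f_{k,l} ≥ 0` for all `(k,l)`, `f₀₀ > 0`,
and `F = ∑ f_{k,l} g_{k,l}` is nonpositive on `A(X)`, then `|X| ≤ F(1)/f₀₀`. -/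
theorem stmt_11 {d : ℕ} (hd : 2 ≤ d)
    (X : Finset (Fin d → ℂ)) (hXne : X.Nonempty)
    (hXsphere : ∀ x ∈ X, cInner x x = 1)
    (f : (ℕ × ℕ) →₀ ℝ) (hfpos : ∀ kl : ℕ × ℕ, 0 ≤ f kl) (hf0 : 0 < f (0, 0))
    (hF : ∀ α ∈ innerSet X,
      (∑ kl ∈ f.support, (f kl : ℂ) * jacobi d kl.1 kl.2 α).im = 0 ∧
      (∑ kl ∈ f.support, (f kl : ℂ) * jacobi d kl.1 kl.2 α).re ≤ 0) :
    (X.card : ℝ) ≤ (∑ kl ∈ f.support, (f kl : ℂ) * jacobi d kl.1 kl.2 1).re / f (0, 0) := by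
  set F : ℂ → ℂ := fun α => ∑ kl ∈ f.support, (f kl : ℂ) * jacobi d kl.1 kl.2 α with hFdef
  change (X.card : ℝ) ≤ (F 1).re / f (0, 0)
  have hn : (0 : ℝ) < X.card := by exact_mod_cast hXne.card_pos
  have swap : ∑ x ∈ X, ∑ y ∈ X, F (cInner y x)
      = ∑ kl ∈ f.support, (f kl : ℂ) * ∑ x ∈ X, ∑ y ∈ X, jacobi d kl.1 kl.2 (cInner y x) := by
    simp only [hFdef, Finset.mul_sum]
    rw [Finset.sum_comm' (t' := f.support) (s' := fun _ => X) (by tauto) |>.symm]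
    refine Finset.sum_congr rfl fun x _ => ?_
    rw [Finset.sum_comm]
  have lower : f (0,0) * (X.card : ℝ) ^ 2 ≤ (∑ x ∈ X, ∑ y ∈ X, F (cInner y x)).re := by
    rw [swap, Complex.re_sum]
    have h0 : (0,0) ∈ f.support := Finsupp.mem_support_iff.2 hf0.ne'
    refine le_trans (le_of_eq ?_) (Finset.single_le_sum (fun kl _ => ?_) h0)
    · simp only [LPB.jacobi_zero hd, Complex.re_ofReal_mul]
      simp [sq]
    · rw [Complex.re_ofReal_mul]
      exact mul_nonneg (hfpos kl) (LPB.jacobi_psd hd X hXsphere _ _)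
  have upper : (∑ x ∈ X, ∑ y ∈ X, F (cInner y x)).re ≤ X.card * (F 1).re := by
    rw [Complex.re_sum, ← nsmul_eq_mul]
    refine Finset.sum_le_card_nsmul _ _ _ fun x hx => ?_
    rw [Complex.re_sum, ← Finset.add_sum_erase X _ hx, hXsphere x hx]
    have : ∑ y ∈ X.erase x, (F (cInner y x)).re ≤ 0 := by
      refine Finset.sum_nonpos fun y hy => ?_
      refine (hF (cInner y x) ?_).2
      simp only [innerSet, Finset.mem_image, Finset.mem_filter, Finset.mem_product]
      exact ⟨(y, x), ⟨⟨Finset.mem_of_mem_erase hy, hx⟩, Finset.ne_of_mem_erase hy⟩, rfl⟩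
    linarith
  rw [le_div_iff₀ hf0]
  have h := lower.trans upper
  nlinarith
end

section
/- Let d ≥ 2, let 𝒮 be a lower set, and let X ⊆ Ω(d) be finite and nonempty. Suppose f_{k,l} > 0 for each (k,l) ∈ 𝒮 are real numbers such that the function F(x) = Σ_{(k,l)∈𝒮} f_{k,l}·g_{k,l}(x) satisfies F(α) = 0 for every α ∈ A(X) (so F is an annihilator polynomial of X). Then for every (k,l) ∈ 𝒮, |X| ≤ F(1)/f_{k,l}. -/
open Finset

open scoped Classical


namespace Fis
open MvPolynomial
open scoped ComplexOrder

/-- Polynomials in the variables `z_i` and `w_i`. -/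
abbrev Pol (d : ℕ) := MvPolynomial (Fin d ⊕ Fin d) ℂ

/-- Factorial of an exponent. -/
noncomputable def mfac {d : ℕ} (m : Fin d ⊕ Fin d →₀ ℕ) : ℂ := ∏ i, (Nat.factorial (m i) : ℂ)

/-- Bilinear Fischer form. -/
noncomputable def bil (d : ℕ) : Pol d →ₗ[ℂ] Pol d →ₗ[ℂ] ℂ :=
  (basisMonomials (Fin d ⊕ Fin d) ℂ).constr ℂ (fun m => mfac m • lcoeff ℂ m)

lemma bil_mono {d : ℕ} (m) (c : ℂ) (q : Pol d) :
    bil d (monomial m c) q = c * mfac m * coeff m q := by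
  have h : (monomial m c : Pol d) = c • basisMonomials (Fin d ⊕ Fin d) ℂ m := by
    simp [smul_monomial]
  rw [h, map_smul, bil, Module.Basis.constr_basis]
  simp [lcoeff, mul_assoc]

lemma mfac_add {d : ℕ} (m : Fin d ⊕ Fin d →₀ ℕ) (i) :
    mfac (m + Finsupp.single i 1) = (m i + 1) * mfac m := by
  unfold mfac
  rw [← Finset.mul_prod_erase _ _ (Finset.mem_univ i), ← Finset.mul_prod_erase _ _ (Finset.mem_univ i),
    ← mul_assoc]
  congr 1
  · simp [Nat.factorial_succ]
  · apply Finset.prod_congr rfl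
    intro j hj
    have : j ≠ i := Finset.ne_of_mem_erase hj
    simp [this]

lemma bil_X {d : ℕ} (i) (p q : Pol d) : bil d (X i * p) q = bil d p (pderiv i q) := by
  induction p using MvPolynomial.induction_on' with
  | monomial m c =>
    rw [mul_comm, X, monomial_mul, bil_mono, bil_mono, mfac_add, coeff_pderiv]
    ring
  | add p q hp hq => simp [mul_add, hp, hq]

/-- directional derivative in the `z` variables -/
noncomputable def D {d : ℕ} (v : Fin d ⊕ Fin d → ℂ) (q : Pol d) : Pol d := ∑ i, C (v i) * pderiv i q

/-- linear form -/
noncomputable def L {d : ℕ} (v : Fin d ⊕ Fin d → ℂ) : Pol d := ∑ i, C (v i) * X i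

lemma bil_L {d : ℕ} (v) (p q : Pol d) : bil d (L v * p) q = bil d p (D v q) := by
  simp only [L, D, Finset.sum_mul, map_sum, LinearMap.sum_apply, mul_assoc, ← smul_eq_C_mul, map_smul,
    LinearMap.smul_apply]
  simp [bil_X]

/-- `∑ z_i w_i` -/
noncomputable def R (d : ℕ) : Pol d := ∑ i : Fin d, X (Sum.inl i) * X (Sum.inr i)

/-- Laplacian -/
noncomputable def Lap {d : ℕ} : Pol d →ₗ[ℂ] Pol d :=
  ∑ i : Fin d, (pderiv (R := ℂ) (Sum.inr i)).toLinearMap ∘ₗ (pderiv (Sum.inl i)).toLinearMap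

lemma Lap_apply {d : ℕ} (p : Pol d) :
    Lap p = ∑ i : Fin d, pderiv (Sum.inr i) (pderiv (Sum.inl i) p) := by
  simp [Lap]

lemma bil_R {d : ℕ} (p q : Pol d) : bil d (R d * p) q = bil d p (Lap q) := by
  simp only [R, Finset.sum_mul, map_sum, LinearMap.sum_apply, mul_assoc, Lap_apply, bil_X]

/-- bidegree weights -/
def wt (d : ℕ) : Fin d ⊕ Fin d → ℕ × ℕ := Sum.elim (fun _ => (1,0)) (fun _ => (0,1))

/-- Bihomogeneous polynomials -/
abbrev BH {d : ℕ} (p : Pol d) (k l : ℕ) : Prop := IsWeightedHomogeneous (wt d) p (k,l)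

lemma BH.fst {d : ℕ} {p : Pol d} {k l : ℕ} (h : BH p k l) :
    IsWeightedHomogeneous (fun i => (wt d i).1) p k := by
  intro m hm
  have := congrArg Prod.fst (h hm)
  change _ = k at this
  rw [← this]
  simp [Finsupp.weight_apply, Finsupp.sum, Prod.fst_sum]

lemma BH.snd {d : ℕ} {p : Pol d} {k l : ℕ} (h : BH p k l) :
    IsWeightedHomogeneous (fun i => (wt d i).2) p l := by
  intro m hm
  have := congrArg Prod.snd (h hm)
  change _ = l at this
  rw [← this]
  simp [Finsupp.weight_apply, Finsupp.sum, Prod.snd_sum]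

lemma bh_D_inl {d : ℕ} {p : Pol d} {k l : ℕ} (h : BH p (k+1) l) (a : Fin d → ℂ) :
    BH (D (Sum.elim a 0) p) k l := by
  apply IsWeightedHomogeneous.sum
  rintro (i | i) -
  · exact (h.pderiv (by simp [wt])).C_mul _
  · simpa using isWeightedHomogeneous_zero _ _ _

lemma bh_D_inr {d : ℕ} {p : Pol d} {k l : ℕ} (h : BH p k (l+1)) (a : Fin d → ℂ) :
    BH (D (Sum.elim 0 a) p) k l := by
  apply IsWeightedHomogeneous.sum
  rintro (i | i) -
  · simpa using isWeightedHomogeneous_zero _ _ _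
  · exact (h.pderiv (by simp [wt])).C_mul _

lemma eval_D_inl {d : ℕ} {p : Pol d} {k l : ℕ} (h : BH p k l) (a b : Fin d → ℂ) :
    eval (Sum.elim a b) (D (Sum.elim a 0) p) = k * eval (Sum.elim a b) p := by
  have := congrArg (eval (Sum.elim a b)) h.fst.sum_weight_X_mul_pderiv
  simpa [wt, D] using this

lemma eval_D_inr {d : ℕ} {p : Pol d} {k l : ℕ} (h : BH p k l) (a b : Fin d → ℂ) :
    eval (Sum.elim a b) (D (Sum.elim 0 b) p) = l * eval (Sum.elim a b) p := by
  have := congrArg (eval (Sum.elim a b)) h.snd.sum_weight_X_mul_pderiv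
  simpa [wt, D] using this

lemma bil_eval {d : ℕ} (a b : Fin d → ℂ) (k l : ℕ) (p : Pol d) (h : BH p k l) :
    bil d (L (Sum.elim a 0) ^ k * L (Sum.elim 0 b) ^ l) p =
      Nat.factorial k * Nat.factorial l * eval (Sum.elim a b) p := by
  induction k generalizing p with
  | zero =>
    induction l generalizing p with
    | zero =>
      have hc : p = C (coeff 0 p) := by
        apply MvPolynomial.ext
        intro m
        rw [coeff_C]
        split_ifs with hm
        · rw [hm]
        · by_contra hne
          apply hm
          have h1 := h hne
          ext i
          rw [Finsupp.weight_apply, Finsupp.sum_fintype _ _ (by simp)] at h1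
          have h2 := congrArg (fun t => t.1 + t.2) h1
          simp only [Prod.fst_sum, Prod.snd_sum, ← Finset.sum_add_distrib] at h2
          have h3 := (Finset.sum_eq_zero_iff.1 h2) i (Finset.mem_univ i)
          rcases i with i | i <;> simpa [wt, eq_comm] using h3
      have h1 : (1 : Pol d) = monomial 0 1 := rfl
      rw [hc, pow_zero, pow_zero, mul_one, h1, bil_mono]
      simp [mfac]
    | succ l ih =>
      rw [pow_succ', ← mul_assoc, mul_comm _ (L (Sum.elim 0 b)), mul_assoc, bil_L, ih _ (bh_D_inr h b),
        eval_D_inr h, Nat.factorial_succ]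
      push_cast; ring
  | succ k ih =>
    rw [pow_succ', mul_assoc, bil_L, ih _ (bh_D_inl h a), eval_D_inl h, Nat.factorial_succ]
    push_cast; ring

/-- conjugation of coefficients -/
noncomputable abbrev cj {d : ℕ} (p : Pol d) : Pol d := map (starRingEnd ℂ) p

lemma bil_cj {d : ℕ} (p q : Pol d) :
    bil d (cj p) q = ∑ m ∈ p.support, starRingEnd ℂ (coeff m p) * mfac m * coeff m q := by
  conv_lhs => rw [cj, p.as_sum]
  simp only [map_sum, map_monomial, LinearMap.sum_apply, bil_mono]

lemma bil_self {d : ℕ} (p : Pol d) :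
    bil d (cj p) p = ((∑ m ∈ p.support, ‖coeff m p‖^2 * ∏ i, (Nat.factorial (m i) : ℝ) : ℝ) : ℂ) := by
  rw [bil_cj]
  push_cast
  apply Finset.sum_congr rfl
  intro m _
  rw [← Complex.conj_mul', mfac]; ring

lemma bil_self_nonneg {d : ℕ} (p : Pol d) : 0 ≤ bil d (cj p) p := by
  rw [bil_self]
  exact_mod_cast Finset.sum_nonneg (fun m _ => by positivity)

lemma bil_self_eq_zero {d : ℕ} (p : Pol d) (h : bil d (cj p) p = 0) : p = 0 := by
  rw [bil_self] at h
  have h' : (∑ m ∈ p.support, ‖coeff m p‖^2 * ∏ i, (Nat.factorial (m i) : ℝ) : ℝ) = 0 := by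
    exact_mod_cast h
  rw [Finset.sum_eq_zero_iff_of_nonneg (fun m _ => by positivity)] at h'
  by_contra hp
  obtain ⟨m, hm⟩ := MvPolynomial.support_nonempty.2 hp
  have h2 := h' m hm
  rw [mem_support_iff] at hm
  have : (∏ i, (Nat.factorial (m i) : ℝ)) ≠ 0 :=
    Finset.prod_ne_zero_iff.2 (fun i _ => by exact_mod_cast (Nat.factorial_ne_zero _))
  rcases mul_eq_zero.1 h2 with h3 | h3
  · simp [hm] at h3
  · exact this h3

lemma cj_R (d : ℕ) : cj (R d) = R d := by simp [cj, R]

/-- coefficients of Jacobi polynomial -/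
noncomputable def jc (d k l r : ℕ) : ℂ :=
  ((-1 : ℂ) ^ r * (Nat.factorial (d + k + l - r - 2) : ℂ)) /
          ((Nat.factorial r : ℂ) * (Nat.factorial (k - r) : ℂ) * (Nat.factorial (l - r) : ℂ))

noncomputable def jK (d k l : ℕ) : ℂ :=
  ((d + k + l - 1 : ℕ) : ℂ) / (Nat.factorial (d - 1) : ℂ)

noncomputable def PA {d : ℕ} (y : Fin d → ℂ) : Pol d := L (Sum.elim y 0)
noncomputable def PB {d : ℕ} (y : Fin d → ℂ) : Pol d := L (Sum.elim 0 (fun i => starRingEnd ℂ (y i)))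

lemma PA_eq {d : ℕ} (y : Fin d → ℂ) : PA y = ∑ i, C (y i) * X (Sum.inl i) := by
  simp [PA, L]
lemma PB_eq {d : ℕ} (y : Fin d → ℂ) : PB y = ∑ i, C (starRingEnd ℂ (y i)) * X (Sum.inr i) := by
  simp [PB, L]

lemma pA_l {d : ℕ} (y : Fin d → ℂ) (i) : pderiv (Sum.inl i) (PA y) = C (y i) := by
  simp [PA_eq, pderiv_X, Pi.single_apply]
lemma pA_r {d : ℕ} (y : Fin d → ℂ) (i) : pderiv (Sum.inr i) (PA y) = 0 := by
  simp [PA_eq, pderiv_X, Pi.single_apply]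
lemma pB_l {d : ℕ} (y : Fin d → ℂ) (i) : pderiv (Sum.inl i) (PB y) = 0 := by
  simp [PB_eq, pderiv_X, Pi.single_apply]
lemma pB_r {d : ℕ} (y : Fin d → ℂ) (i) :
    pderiv (Sum.inr i) (PB y) = C (starRingEnd ℂ (y i)) := by
  simp [PB_eq, pderiv_X, Pi.single_apply]
lemma pR_l {d : ℕ} (i) : pderiv (Sum.inl i) (R d) = X (Sum.inr i) := by
  simp [R, pderiv_X, Pi.single_apply]
lemma pR_r {d : ℕ} (i) : pderiv (Sum.inr i) (R d) = X (Sum.inl i) := by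
  simp [R, pderiv_X, Pi.single_apply]

lemma cast_mul_pow {d : ℕ} (a : ℕ) (p : Pol d) : (a : Pol d) * p ^ (a - 1) * p = a * p ^ a := by
  cases a with
  | zero => simp
  | succ a => rw [Nat.add_sub_cancel, pow_succ]; ring

lemma Lap_term {d : ℕ} (y : Fin d → ℂ) (a b r : ℕ) (i : Fin d) :
    pderiv (Sum.inr i) (pderiv (Sum.inl i) (PA y ^ a * PB y ^ b * R d ^ r)) =
      ((b : Pol d) * PB y ^ (b-1) * ((a : Pol d) * PA y ^ (a-1)) * R d ^ r) * (C (y i) * C (starRingEnd ℂ (y i)))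
      + (PB y ^ b * ((a : Pol d) * PA y ^ (a-1)) * ((r : Pol d) * R d ^ (r-1))) * (C (y i) * X (Sum.inl i))
      + ((b : Pol d) * PB y ^ (b-1) * PA y ^ a * ((r : Pol d) * R d ^ (r-1))) * (C (starRingEnd ℂ (y i)) * X (Sum.inr i))
      + (PB y ^ b * PA y ^ a * (r : Pol d) * (((r-1 : ℕ) : Pol d) * R d ^ (r-1-1))) * (X (Sum.inl i) * X (Sum.inr i))
      + (PB y ^ b * PA y ^ a * (r : Pol d) * R d ^ (r-1)) := by
  have h1 : pderiv (Sum.inl i) (PA y ^ a * PB y ^ b * R d ^ r) =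
      C (a : ℂ) * PA y ^ (a-1) * PB y ^ b * R d ^ r * C (y i) +
       C (r : ℂ) * PA y ^ a * PB y ^ b * R d ^ (r-1) * X (Sum.inr i) := by
    simp only [pderiv_mul, pderiv_pow, pA_l, pB_l, pR_l, map_natCast]
    ring
  rw [h1]
  simp only [map_add, pderiv_mul, pderiv_pow, pA_r, pB_r, pR_r, pderiv_C, pderiv_X_self]
  simp only [map_natCast]
  ring

lemma Lap_prod {d : ℕ} (y : Fin d → ℂ) (hy : cInner y y = 1) (a b r : ℕ) :
    Lap (PA y ^ a * PB y ^ b * R d ^ r) =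
      C ((a : ℂ) * b) * (PA y ^ (a-1) * PB y ^ (b-1) * R d ^ r) +
      C ((r : ℂ) * (a + b + d + r - 1)) * (PA y ^ a * PB y ^ b * R d ^ (r-1)) := by
  have hy' : ∑ i, (C (y i) * C (starRingEnd ℂ (y i)) : Pol d) = 1 := by
    simp only [← C_mul, ← map_sum]
    rw [← C_1, ← hy, cInner]
    simp only [mul_comm]
  rw [Lap_apply]
  simp only [Lap_term, Finset.sum_add_distrib, ← Finset.mul_sum]
  rw [hy', ← PA_eq, ← PB_eq, ← R]
  simp only [Finset.sum_const, Finset.card_univ, Fintype.card_fin, nsmul_eq_mul]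
  have e1 := cast_mul_pow a (PA y)
  have e2 := cast_mul_pow b (PB y)
  have e3 := cast_mul_pow (r-1) (R d)
  have e4 : (r : Pol d) * ((r - 1 : ℕ) : Pol d) = r * (r - 1) := by
    cases r <;> simp
  simp only [map_mul, map_add, map_sub, map_natCast, map_one]
  linear_combination (PB y ^ b * (r * R d ^ (r-1))) * e1 + (PA y ^ a * (r * R d ^ (r-1))) * e2
    + (PB y ^ b * PA y ^ a * r) * e3 + (PB y ^ b * PA y ^ a * R d ^ (r-1)) * e4

noncomputable def G {d : ℕ} (k l : ℕ) (y : Fin d → ℂ) : Pol d :=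
  C (jK d k l) * ∑ r ∈ Finset.range (min k l + 1),
    C (jc d k l r) * (PA y ^ (k - r) * PB y ^ (l - r) * R d ^ r)

lemma jc_succ {d k l r : ℕ} (hd : 2 ≤ d) (hr : r < min k l) :
    jc d k l r * ((k - r : ℕ) * (l - r : ℕ)) +
      jc d k l (r+1) * ((r + 1 : ℕ) * ((k - (r+1) : ℕ) + (l - (r+1) : ℕ) + d + (r + 1 : ℕ) - 1)) = 0 := by
  obtain ⟨hk, hl⟩ := lt_min_iff.1 hr
  obtain ⟨k, rfl⟩ := Nat.exists_eq_add_of_lt hk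
  obtain ⟨l, rfl⟩ := Nat.exists_eq_add_of_lt hl
  obtain ⟨d, rfl⟩ := Nat.exists_eq_add_of_le hd
  unfold jc
  have a1 : 2 + d + (r + k + 1) + (r + l + 1) - r - 2 = d + k + l + r + 1 + 1 := by omega
  have a2 : 2 + d + (r + k + 1) + (r + l + 1) - (r + 1) - 2 = d + k + l + r + 1 := by omega
  have a3 : r + k + 1 - r = k + 1 := by omega
  have a4 : r + l + 1 - r = l + 1 := by omega
  have a5 : r + k + 1 - (r + 1) = k := by omega
  have a6 : r + l + 1 - (r + 1) = l := by omega
  rw [a1, a2, a3, a4, a5, a6, Nat.factorial_succ (d + k + l + r + 1), Nat.factorial_succ r,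
    Nat.factorial_succ k, Nat.factorial_succ l]
  have b1 : (Nat.factorial r : ℂ) ≠ 0 := by exact_mod_cast Nat.factorial_ne_zero _
  have b2 : (Nat.factorial k : ℂ) ≠ 0 := by exact_mod_cast Nat.factorial_ne_zero _
  have b3 : (Nat.factorial l : ℂ) ≠ 0 := by exact_mod_cast Nat.factorial_ne_zero _
  have c1 : ((r : ℂ) + 1) ≠ 0 := Nat.cast_add_one_ne_zero r
  have c2 : ((k : ℂ) + 1) ≠ 0 := Nat.cast_add_one_ne_zero k
  have c3 : ((l : ℂ) + 1) ≠ 0 := Nat.cast_add_one_ne_zero l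
  push_cast
  field_simp
  ring

lemma Lap_C {d : ℕ} (c : ℂ) (p : Pol d) : Lap (C c * p) = C c * Lap p := by
  rw [← smul_eq_C_mul, map_smul, smul_eq_C_mul]

lemma Lap_G {d : ℕ} (hd : 2 ≤ d) (k l : ℕ) (y : Fin d → ℂ) (hy : cInner y y = 1) :
    Lap (G k l y) = 0 := by
  rw [G, Lap_C, map_sum]
  simp only [Lap_C, Lap_prod y hy, mul_add, Finset.sum_add_distrib]
  rw [Finset.sum_range_succ, Finset.sum_range_succ' (n := min k l)]
  have h0 : ((k - min k l : ℕ) : ℂ) * ((l - min k l : ℕ) : ℂ) = 0 := by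
    rcases le_total k l with h | h <;> simp [h]
  rw [h0]
  simp only [map_zero, zero_mul, mul_zero, add_zero, Nat.cast_zero]
  rw [← mul_add, ← Finset.sum_add_distrib]
  rw [Finset.sum_eq_zero, mul_zero]
  intro r hr
  have := congrArg (C (σ := Fin d ⊕ Fin d)) (jc_succ hd (Finset.mem_range.1 hr))
  rw [Nat.add_sub_cancel, Nat.sub_sub, Nat.sub_sub]
  rw [map_add, map_mul, map_mul (C (σ := Fin d ⊕ Fin d)) (jc d k l (r+1)), map_zero] at this
  linear_combination (PA y ^ (k - (r + 1)) * PB y ^ (l - (r + 1)) * R d ^ r) * this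

lemma bh_PA {d : ℕ} (y : Fin d → ℂ) : BH (PA y) 1 0 := by
  rw [PA_eq]
  exact IsWeightedHomogeneous.sum _ _ _ (fun i _ => (isWeightedHomogeneous_X ℂ (wt d) (Sum.inl i)).C_mul _)

lemma bh_PB {d : ℕ} (y : Fin d → ℂ) : BH (PB y) 0 1 := by
  rw [PB_eq]
  exact IsWeightedHomogeneous.sum _ _ _ (fun i _ => (isWeightedHomogeneous_X ℂ (wt d) (Sum.inr i)).C_mul _)

lemma bh_R {d : ℕ} : BH (R d) 1 1 := by
  exact IsWeightedHomogeneous.sum _ _ _ (fun i _ => (isWeightedHomogeneous_X ℂ (wt d) (Sum.inl i)).mul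
    (isWeightedHomogeneous_X ℂ (wt d) (Sum.inr i)))

lemma bh_prod {d : ℕ} (y : Fin d → ℂ) (a b r : ℕ) :
    BH (PA y ^ a * PB y ^ b * R d ^ r) (a + r) (b + r) := by
  have := (((bh_PA y).pow a).mul ((bh_PB y).pow b)).mul ((bh_R (d := d)).pow r)
  have e : ((a + r, b + r) : ℕ × ℕ) = a • (1, 0) + b • (0, 1) + r • (1, 1) := by
    ext <;> simp
  rw [BH, e]
  exact this

lemma bh_G {d : ℕ} (k l : ℕ) (y : Fin d → ℂ) : BH (G k l y) k l := by
  refine IsWeightedHomogeneous.C_mul (IsWeightedHomogeneous.sum _ _ _ fun r hr => ?_) _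
  refine IsWeightedHomogeneous.C_mul ?_ _
  have hr' := Finset.mem_range.1 hr
  have := bh_prod y (k - r) (l - r) r
  rwa [Nat.sub_add_cancel (by omega), Nat.sub_add_cancel (by omega)] at this

/-- evaluation point attached to `x` -/
noncomputable def pt {d : ℕ} (x : Fin d → ℂ) : Fin d ⊕ Fin d → ℂ :=
  Sum.elim (fun i => starRingEnd ℂ (x i)) x

lemma eval_G {d : ℕ} (k l : ℕ) (x y : Fin d → ℂ) (hx : cInner x x = 1) :
    eval (pt x) (G k l y) = jacobi d k l (cInner x y) := by
  have h1 : eval (pt x) (PA y) = cInner x y := by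
    simp [PA_eq, pt, cInner, mul_comm]
  have h2 : eval (pt x) (PB y) = starRingEnd ℂ (cInner x y) := by
    simp [PB_eq, pt, cInner, mul_comm]
  have h3 : eval (pt x) (R d) = 1 := by
    rw [← hx]
    simp [R, pt, cInner]
  simp [G, jacobi, h1, h2, h3, jK, jc, mul_assoc]

/-- Gram formula -/
lemma gram {d : ℕ} (hd : 2 ≤ d) (k l : ℕ) : ∃ c : ℝ, 0 < c ∧ ∀ x y : Fin d → ℂ,
    cInner x x = 1 → cInner y y = 1 →
    jacobi d k l (cInner x y) = c * bil d (cj (G k l x)) (G k l y) := by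
  set e : ℝ := ((d + k + l - 1 : ℕ) : ℝ) / (Nat.factorial (d - 1) : ℝ) *
    ((Nat.factorial (d + k + l - 2) : ℝ) / ((Nat.factorial k : ℝ) * (Nat.factorial l : ℝ))) with he
  have hepos : 0 < e := by
    have : 0 < d + k + l - 1 := by omega
    positivity
  have heC : jK d k l * jc d k l 0 = (e : ℂ) := by
    simp [jK, jc, he]
  refine ⟨1 / (e * (Nat.factorial k * Nat.factorial l)), by positivity, fun x y hx hy => ?_⟩
  have hG : ∃ q : Pol d, G k l x = C (e : ℂ) * (PA x ^ k * PB x ^ l) + R d * q := by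
    refine ⟨C (jK d k l) * ∑ r ∈ Finset.range (min k l),
      C (jc d k l (r+1)) * (PA x ^ (k - (r+1)) * PB x ^ (l - (r+1)) * R d ^ r), ?_⟩
    have hs : ∑ r ∈ Finset.range (min k l),
        C (jc d k l (r+1)) * (PA x ^ (k - (r+1)) * PB x ^ (l - (r+1)) * R d ^ (r+1)) =
        R d * ∑ r ∈ Finset.range (min k l),
        C (jc d k l (r+1)) * (PA x ^ (k - (r+1)) * PB x ^ (l - (r+1)) * R d ^ r) := by
      rw [Finset.mul_sum]
      refine Finset.sum_congr rfl fun r _ => ?_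
      rw [pow_succ]
      ring
    rw [G, Finset.sum_range_succ', hs, ← heC, map_mul, Nat.sub_zero, Nat.sub_zero, pow_zero]
    ring
  obtain ⟨q, hq⟩ := hG
  have hc : cj (G k l x) = C (e : ℂ) * (L (Sum.elim (fun i => starRingEnd ℂ (x i)) 0) ^ k *
      L (Sum.elim 0 x) ^ l) + R d * cj q := by
    rw [hq, cj, map_add, map_mul, map_mul (map (starRingEnd ℂ)) (R d), show map (starRingEnd ℂ) (R d) = R d from cj_R d]
    simp [PA, PB, L]
  rw [hc, map_add, LinearMap.add_apply, bil_R, Lap_G hd k l y hy, ← smul_eq_C_mul, map_smul,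
    LinearMap.smul_apply, bil_eval _ _ _ _ _ (bh_G k l y), ← pt, eval_G k l x y hx]
  have h1 : (e : ℂ) ≠ 0 := by exact_mod_cast hepos.ne'
  have b2 : (Nat.factorial k : ℂ) ≠ 0 := by exact_mod_cast Nat.factorial_ne_zero _
  have b3 : (Nat.factorial l : ℂ) ≠ 0 := by exact_mod_cast Nat.factorial_ne_zero _
  rw [map_zero, add_zero, smul_eq_mul]
  push_cast
  field_simp

/-- the dimension of the harmonic space, as a real number -/
noncomputable def jv (d k l : ℕ) : ℝ :=
  ((d + k + l - 1 : ℕ) : ℝ) / (Nat.factorial (d - 1) : ℝ) *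
    ((Nat.factorial (d + k - 2) : ℝ) * (Nat.factorial (d + l - 2) : ℝ) /
      ((Nat.factorial k : ℝ) * (Nat.factorial l : ℝ) * (Nat.factorial (d - 2) : ℝ)))

lemma jv_pos {d : ℕ} (hd : 2 ≤ d) (k l : ℕ) : 0 < jv d k l := by
  have : 0 < d + k + l - 1 := by omega
  unfold jv
  positivity

lemma alt_sum (D k l : ℕ) :
    ∑ r ∈ Finset.range (k + 1), (-1 : ℤ) ^ r * k.choose r * ((D + l + (k - r)).choose (k + D) : ℤ)
      = (D + l).choose D := by
  have h := congrFun (fwdDiff_iter_choose D k) (D + l)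
  rw [fwdDiff_iter_eq_sum_shift, ← Finset.sum_range_reflect] at h
  rw [← h]
  refine Finset.sum_congr rfl fun r hr => ?_
  have hr' : r ≤ k := Nat.lt_succ_iff.1 (Finset.mem_range.1 hr)
  have e1 : k + 1 - 1 - r = k - r := by omega
  have e2 : k - (k - r) = r := by omega
  rw [e1, e2, Nat.choose_symm hr']
  simp

lemma jc_sum {d : ℕ} (hd : 2 ≤ d) (k l : ℕ) :
    ∑ r ∈ Finset.range (min k l + 1), jc d k l r =
     ((Nat.factorial (d + k - 2) : ℂ) * (Nat.factorial (d + l - 2) : ℂ) /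
      ((Nat.factorial k : ℂ) * (Nat.factorial l : ℂ) * (Nat.factorial (d - 2) : ℂ))) := by
  obtain ⟨D, rfl⟩ := Nat.exists_eq_add_of_le hd
  have f0 : ∀ n : ℕ, (Nat.factorial n : ℂ) ≠ 0 := fun n => by exact_mod_cast Nat.factorial_ne_zero _
  have h := congrArg (Int.cast : ℤ → ℂ) (alt_sum D k l)
  push_cast at h
  have hsub : Finset.range (min k l + 1) ⊆ Finset.range (k + 1) := by
    intro r; simp only [Finset.mem_range]; omega
  rw [← Finset.sum_subset hsub] at h
  · have a1 : 2 + D + k - 2 = k + D := by omega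
    have a2 : 2 + D + l - 2 = D + l := by omega
    have a3 : 2 + D - 2 = D := by omega
    rw [a1, a2, a3]
    have h2 : (Nat.factorial (k + D) : ℂ) * (Nat.factorial (D + l) : ℂ) /
      ((Nat.factorial k : ℂ) * (Nat.factorial l : ℂ) * (Nat.factorial D : ℂ)) =
      (Nat.factorial (k + D) : ℂ) / (Nat.factorial k : ℂ) * ((D + l).choose D : ℂ) := by
      rw [Nat.cast_choose ℂ (Nat.le_add_right D l), Nat.add_sub_cancel_left]
      have := f0 k; have := f0 l; have := f0 D
      field_simp
    rw [h2, ← h, Finset.mul_sum]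
    refine Finset.sum_congr rfl fun r hr => ?_
    have hr' := Finset.mem_range.1 hr
    have hk : r ≤ k := by omega
    have hl : r ≤ l := by omega
    rw [Nat.cast_choose ℂ hk, Nat.cast_choose ℂ (by omega : k + D ≤ D + l + (k - r)), jc]
    have b1 : 2 + D + k + l - r - 2 = D + l + (k - r) := by omega
    have b2 : D + l + (k - r) - (k + D) = l - r := by omega
    rw [b1, b2]
    have := f0 k; have := f0 (k + D); have := f0 r; have := f0 (k - r); have := f0 (l - r)
    field_simp
  · intro r hr hr2
    simp only [Finset.mem_range] at hr hr2
    rw [Nat.choose_eq_zero_of_lt (by omega : D + l + (k - r) < k + D)]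
    simp

lemma jacobi_one {d : ℕ} (hd : 2 ≤ d) (k l : ℕ) : jacobi d k l 1 = (jv d k l : ℂ) := by
  have : jacobi d k l 1 = jK d k l * ∑ r ∈ Finset.range (min k l + 1), jc d k l r := by
    simp [jacobi, jK, jc]
  rw [this, jc_sum hd, jv, jK]
  push_cast
  rfl

/-- space of bihomogeneous polynomials -/
noncomputable abbrev BS (d k l : ℕ) : Submodule ℂ (Pol d) := weightedHomogeneousSubmodule ℂ (wt d) (k, l)

/-- exponents -/
def expo (d k l : ℕ) : Set (Fin d ⊕ Fin d →₀ ℕ) := {m | Finsupp.weight (wt d) m = (k, l)}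

lemma mem_expo {d k l : ℕ} (m : Fin d ⊕ Fin d →₀ ℕ) :
    m ∈ expo d k l ↔ (∑ i, m (Sum.inl i) = k ∧ ∑ i, m (Sum.inr i) = l) := by
  rw [expo, Set.mem_ofPred_eq, Finsupp.weight_apply, Finsupp.sum_fintype _ _ (by simp), Prod.ext_iff]
  simp [Prod.fst_sum, Prod.snd_sum, wt]

noncomputable def expoEquiv (d k l : ℕ) : expo d k l ≃
    ((Finset.univ : Finset (Fin d)).finsuppAntidiag k) × ((Finset.univ : Finset (Fin d)).finsuppAntidiag l) :=
  (Finsupp.sumFinsuppEquivProdFinsupp.subtypeEquiv (p := fun m => m ∈ expo d k l)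
    (q := fun ab => ab.1 ∈ (Finset.univ : Finset (Fin d)).finsuppAntidiag k ∧
      ab.2 ∈ (Finset.univ : Finset (Fin d)).finsuppAntidiag l) (by
        intro m
        rw [mem_expo]
        simp only [Finset.mem_finsuppAntidiag, Finset.subset_univ, and_true]
        rfl)).trans
  Equiv.subtypeProdEquivProd

noncomputable def BSbasis (d k l : ℕ) : Module.Basis (expo d k l) ℂ (BS d k l) :=
  (basisRestrictSupport ℂ (expo d k l)).map (LinearEquiv.ofEq _ _
    (weightedHomogeneousSubmodule_eq_finsupp_supported ℂ (wt d) (k, l)).symm)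

noncomputable instance (d k l : ℕ) : Fintype (expo d k l) := Fintype.ofEquiv _ (expoEquiv d k l).symm

instance (d k l : ℕ) : FiniteDimensional ℂ (BS d k l) := (BSbasis d k l).finiteDimensional_of_finite

lemma finrank_BS (d k l : ℕ) :
    Module.finrank ℂ (BS d k l) = (d + k - 1).choose k * (d + l - 1).choose l := by
  rw [Module.finrank_eq_card_basis (BSbasis d k l), Fintype.card_congr (expoEquiv d k l)]
  simp [Finset.card_finsuppAntidiag_nat_eq_choose]

/-- harmonic polynomials -/
noncomputable def HS (d k l : ℕ) : Submodule ℂ (Pol d) := BS d k l ⊓ LinearMap.ker (Lap (d := d))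

lemma HS_le (d k l : ℕ) : HS d k l ≤ BS d k l := inf_le_left

instance (d k l : ℕ) : FiniteDimensional ℂ (HS d k l) :=
  Submodule.finiteDimensional_of_le (HS_le d k l)

lemma R_ne {d : ℕ} (hd : 2 ≤ d) : R d ≠ 0 := by
  intro h
  have := congrArg (eval (fun _ => (1 : ℂ))) h
  simp [R] at this
  omega

lemma finrank_HS_succ {d : ℕ} (hd : 2 ≤ d) (k l : ℕ) :
    Module.finrank ℂ (HS d (k+1) (l+1)) + Module.finrank ℂ (BS d k l) ≤
      Module.finrank ℂ (BS d (k+1) (l+1)) := by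
  have hinj : Function.Injective (LinearMap.mulLeft ℂ (R d)) := by
    intro p q h
    exact mul_left_cancel₀ (R_ne hd) h
  have h1 : Module.finrank ℂ ((BS d k l).map (LinearMap.mulLeft ℂ (R d))) =
      Module.finrank ℂ (BS d k l) := (Submodule.equivMapOfInjective _ hinj _).finrank_eq.symm
  have hdis : HS d (k+1) (l+1) ⊓ (BS d k l).map (LinearMap.mulLeft ℂ (R d)) = ⊥ := by
    rw [eq_bot_iff]
    rintro p ⟨hp, q, hq, rfl⟩
    have hp2 : Lap (R d * q) = 0 := LinearMap.mem_ker.1 hp.2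
    have : R d * q = 0 := by
      apply bil_self_eq_zero
      rw [cj, map_mul (map (starRingEnd ℂ)), show map (starRingEnd ℂ) (R d) = R d from cj_R d, bil_R, hp2, map_zero]
    simpa using this
  have h2 := Submodule.finrank_sup_add_finrank_inf_eq (HS d (k+1) (l+1))
    ((BS d k l).map (LinearMap.mulLeft ℂ (R d)))
  rw [hdis, finrank_bot, add_zero, h1] at h2
  rw [← h2]
  apply Submodule.finrank_mono
  apply sup_le (HS_le _ _ _)
  rintro _ ⟨q, hq, rfl⟩
  have := (bh_R (d := d)).mul ((mem_weightedHomogeneousSubmodule ℂ _ _ _).1 hq)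
  rw [mem_weightedHomogeneousSubmodule]
  have e : ((k + 1, l + 1) : ℕ × ℕ) = (1, 1) + (k, l) := by ext <;> simp [add_comm]
  rw [e]
  exact this

lemma finrank_HS {d : ℕ} (hd : 2 ≤ d) (k l : ℕ) : (Module.finrank ℂ (HS d k l) : ℝ) ≤ jv d k l := by
  obtain ⟨D, rfl⟩ := Nat.exists_eq_add_of_le hd
  have f0 : ∀ n : ℕ, (Nat.factorial n : ℝ) ≠ 0 := fun n => by exact_mod_cast Nat.factorial_ne_zero _
  have hch : ∀ n : ℕ, ((2 + D + n - 1).choose n : ℝ) =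
      (D + n + 1) * (Nat.factorial (D + n) : ℝ) / ((Nat.factorial n : ℝ) * ((D + 1) * Nat.factorial D)) := by
    intro n
    have e : 2 + D + n - 1 = D + n + 1 := by omega
    rw [e, Nat.cast_choose ℝ (by omega : n ≤ D + n + 1)]
    have e2 : D + n + 1 - n = D + 1 := by omega
    rw [e2, Nat.factorial_succ, Nat.factorial_succ]
    push_cast
    rfl
  have hjv : ∀ k l : ℕ, jv (2 + D) k l = ((D + k + l + 1) : ℝ) / ((D + 1) * Nat.factorial D) *
    ((Nat.factorial (D + k) : ℝ) * (Nat.factorial (D + l) : ℝ) /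
      ((Nat.factorial k : ℝ) * (Nat.factorial l : ℝ) * (Nat.factorial D : ℝ))) := by
    intro k l
    unfold jv
    have e1 : 2 + D + k + l - 1 = D + k + l + 1 := by omega
    have e2 : 2 + D - 1 = D + 1 := by omega
    have e3 : 2 + D + k - 2 = D + k := by omega
    have e4 : 2 + D + l - 2 = D + l := by omega
    have e5 : 2 + D - 2 = D := by omega
    rw [e1, e2, e3, e4, e5, Nat.factorial_succ]
    push_cast
    rfl
  have hD : (D : ℝ) + 1 ≠ 0 := by positivity
  have hDf := f0 D
  by_cases h : k = 0 ∨ l = 0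
  · have h1 : (Module.finrank ℂ (HS (2 + D) k l) : ℝ) ≤ Module.finrank ℂ (BS (2 + D) k l) := by
      exact_mod_cast Submodule.finrank_mono (HS_le _ _ _)
    refine h1.trans (le_of_eq ?_)
    rw [finrank_BS, Nat.cast_mul, hch, hch, hjv]
    have := f0 k; have := f0 l
    rcases h with rfl | rfl
    · simp only [Nat.factorial_zero, Nat.cast_zero, Nat.cast_one, add_zero]
      field_simp
    · simp only [Nat.factorial_zero, Nat.cast_zero, Nat.cast_one, add_zero]
      field_simp
  · push Not at h
    obtain ⟨k, rfl⟩ := Nat.exists_eq_succ_of_ne_zero h.1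
    obtain ⟨l, rfl⟩ := Nat.exists_eq_succ_of_ne_zero h.2
    have h1 : ((Module.finrank ℂ (HS (2 + D) (k+1) (l+1)) : ℝ) + Module.finrank ℂ (BS (2 + D) k l)) ≤
      Module.finrank ℂ (BS (2 + D) (k+1) (l+1)) := by exact_mod_cast finrank_HS_succ hd k l
    rw [finrank_BS, finrank_BS, Nat.cast_mul, Nat.cast_mul, hch, hch, hch, hch] at h1
    rw [Nat.succ_eq_add_one, Nat.succ_eq_add_one, hjv]
    refine (le_sub_iff_add_le.2 h1).trans (le_of_eq ?_)
    have := f0 k; have := f0 l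
    have hk : (k : ℝ) + 1 ≠ 0 := by positivity
    have hl : (l : ℝ) + 1 ≠ 0 := by positivity
    rw [← add_assoc, ← add_assoc, Nat.factorial_succ, Nat.factorial_succ (D + l), Nat.factorial_succ k,
      Nat.factorial_succ l]
    push_cast
    field_simp
    ring

/-- Gram matrix -/
noncomputable def Mat {d : ℕ} (X : Finset (Fin d → ℂ)) (k l : ℕ) : Matrix X X ℂ :=
  fun x y => jacobi d k l (cInner x.1 y.1)

lemma rank_Mat {d : ℕ} (hd : 2 ≤ d) (X : Finset (Fin d → ℂ)) (hX : ∀ x ∈ X, cInner x x = 1) (k l : ℕ) :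
    ((Mat X k l).rank : ℝ) ≤ jv d k l := by
  refine le_trans ?_ (finrank_HS hd k l)
  let ev : Pol d →ₗ[ℂ] (X → ℂ) := LinearMap.pi (fun x => (aeval (R := ℂ) (pt x.1)).toLinearMap)
  have h1 : Submodule.span ℂ (Set.range (Mat X k l).col) ≤ (HS d k l).map ev := by
    rw [Submodule.span_le]
    rintro _ ⟨y, rfl⟩
    refine ⟨G k l y.1, ⟨bh_G k l y.1, LinearMap.mem_ker.2 (Lap_G hd k l y.1 (hX _ y.2))⟩, ?_⟩
    ext x
    have := eval_G k l x.1 y.1 (hX _ x.2)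
    simpa [ev, Mat, Matrix.col, aeval_eq_eval] using this
  rw [Matrix.rank_eq_finrank_span_cols]
  exact_mod_cast (Submodule.finrank_mono h1).trans (Submodule.finrank_map_le _ _)

lemma cInner_conj {d : ℕ} (x y : Fin d → ℂ) : starRingEnd ℂ (cInner x y) = cInner y x := by
  simp [cInner, mul_comm]

lemma herm_Mat {d : ℕ} (X : Finset (Fin d → ℂ)) (k l : ℕ) : (Mat X k l).IsHermitian := by
  ext x y
  rw [Matrix.conjTranspose_apply, Mat, Mat, ← cInner_conj y.1 x.1]
  simp [jacobi]

lemma psd_Mat {d : ℕ} (hd : 2 ≤ d) (X : Finset (Fin d → ℂ)) (hX : ∀ x ∈ X, cInner x x = 1) (k l : ℕ) :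
    (Mat X k l).PosSemidef := by
  refine Matrix.PosSemidef.of_dotProduct_mulVec_nonneg (herm_Mat X k l) fun v => ?_
  obtain ⟨c, hc, h⟩ := gram hd k l
  have : star v ⬝ᵥ (Mat X k l).mulVec v =
      c * bil d (cj (∑ x : X, C (v x) * G k l x.1)) (∑ x : X, C (v x) * G k l x.1) := by
    simp only [dotProduct, Matrix.mulVec, Mat, cj, map_sum, map_mul (map (starRingEnd ℂ)), map_C]
    simp only [← smul_eq_C_mul, map_smul, LinearMap.sum_apply, LinearMap.smul_apply, Finset.mul_sum, smul_eq_mul]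
    rw [Finset.sum_comm]
    refine Finset.sum_congr rfl fun x _ => Finset.sum_congr rfl fun y _ => ?_
    rw [h _ _ (hX _ y.2) (hX _ x.2)]
    simp only [Pi.star_apply, RCLike.star_def, cj]
    ring
  rw [this]
  exact mul_nonneg (by exact_mod_cast hc.le) (bil_self_nonneg _)

end Fis

open scoped ComplexOrder in
/-- if `F = ∑_{(k,l)∈S} f_{k,l} g_{k,l}` with all `f_{k,l} > 0`
annihilates `A(X)`, then `|X| ≤ F(1)/f_{k,l}` for every `(k,l) ∈ S`. -/
theorem stmt_12 {d : ℕ} (hd : 2 ≤ d) (S : Finset (ℕ × ℕ)) (hS : IsLowerSet' S)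
    (X : Finset (Fin d → ℂ)) (hXne : X.Nonempty)
    (hXsphere : ∀ x ∈ X, cInner x x = 1)
    (f : ℕ × ℕ → ℝ) (hfpos : ∀ kl ∈ S, 0 < f kl)
    (hann : ∀ α ∈ innerSet X, ∑ kl ∈ S, (f kl : ℂ) * jacobi d kl.1 kl.2 α = 0) :
    ∀ kl ∈ S, (X.card : ℝ) ≤ (∑ mn ∈ S, (f mn : ℂ) * jacobi d mn.1 mn.2 1).re / f kl := by
  classical
  intro kl hkl
  have hf := hfpos kl hkl
  rw [le_div_iff₀ hf]
  set F : ℝ := (∑ mn ∈ S, (f mn : ℂ) * jacobi d mn.1 mn.2 1).re with hF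
  have hFC : ∑ mn ∈ S, (f mn : ℂ) * jacobi d mn.1 mn.2 1 = (F : ℂ) := by
    have : ∑ mn ∈ S, (f mn : ℂ) * jacobi d mn.1 mn.2 1 =
        ((∑ mn ∈ S, f mn * Fis.jv d mn.1 mn.2 : ℝ) : ℂ) := by
      push_cast
      exact Finset.sum_congr rfl fun mn _ => by rw [Fis.jacobi_one hd]
    rw [hF, this, Complex.ofReal_re]
  have hsum : ∑ mn ∈ S, (f mn : ℂ) • Fis.Mat X mn.1 mn.2 = (F : ℂ) • (1 : Matrix X X ℂ) := by
    ext x y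
    rw [Matrix.sum_apply]
    simp only [Matrix.smul_apply, Fis.Mat, smul_eq_mul]
    by_cases hxy : x = y
    · subst hxy
      rw [hXsphere _ x.2, hFC]
      simp
    · rw [hann, Matrix.one_apply_ne hxy, mul_zero]
      simp only [innerSet, Finset.mem_image, Finset.mem_filter, Finset.mem_product]
      exact ⟨(x.1, y.1), ⟨⟨x.2, y.2⟩, fun h => hxy (Subtype.ext h)⟩, rfl⟩
  have hpsd : (∑ mn ∈ S.erase kl, (f mn : ℂ) • Fis.Mat X mn.1 mn.2).PosSemidef :=
    Matrix.posSemidef_sum _ fun mn hmn => (Fis.psd_Mat hd X hXsphere mn.1 mn.2).smul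
      (by exact_mod_cast (hfpos mn (Finset.mem_of_mem_erase hmn)).le)
  rw [← Finset.add_sum_erase S _ hkl] at hsum
  set M := Fis.Mat X kl.1 kl.2 with hM
  have hH : M.IsHermitian := Fis.herm_Mat X kl.1 kl.2
  have heig : ∀ i, f kl * hH.eigenvalues i ≤ F := by
    intro i
    set v : X → ℂ := ⇑(hH.eigenvectorBasis i) with hv
    have h1 : M.mulVec v = (hH.eigenvalues i) • v := hH.mulVec_eigenvectorBasis i
    have h2 := hpsd.dotProduct_mulVec_nonneg v
    rw [eq_sub_of_add_eq' hsum, Matrix.sub_mulVec, Matrix.smul_mulVec, Matrix.smul_mulVec, h1,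
      Matrix.one_mulVec] at h2
    have hv0 : v ≠ 0 := by
      intro h0
      have := hH.eigenvectorBasis.orthonormal.ne_zero i
      apply this
      ext j
      exact congrFun h0 j
    have h3 : 0 < star v ⬝ᵥ v := Matrix.dotProduct_star_self_pos_iff.2 hv0
    have h4 : star v ⬝ᵥ ((F : ℂ) • v - (f kl : ℂ) • hH.eigenvalues i • v) =
        ((F - f kl * hH.eigenvalues i : ℝ) : ℂ) * (star v ⬝ᵥ v) := by
      rw [dotProduct_sub, dotProduct_smul, dotProduct_smul, dotProduct_smul]
      simp only [smul_eq_mul, Complex.real_smul]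
      push_cast
      ring
    rw [h4] at h2
    by_contra hlt
    push Not at hlt
    have h5 : ((F - f kl * hH.eigenvalues i : ℝ) : ℂ) < 0 := by
      exact_mod_cast sub_neg.2 hlt
    exact absurd h2 (not_le_of_gt (mul_neg_of_neg_of_pos h5 h3))
  have htr : (X.card : ℝ) * Fis.jv d kl.1 kl.2 = ∑ i, hH.eigenvalues i := by
    have h1 := hH.trace_eq_sum_eigenvalues
    have h2 : M.trace = ((X.card : ℝ) * Fis.jv d kl.1 kl.2 : ℝ) := by
      rw [Matrix.trace]
      simp only [Matrix.diag_apply, hM, Fis.Mat]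
      rw [Finset.sum_congr rfl (fun x _ => by rw [hXsphere _ x.2, Fis.jacobi_one hd])]
      simp
    rw [h2] at h1
    rw [← Complex.ofReal_inj, h1]
    simp
  have hrank := Fis.rank_Mat hd X hXsphere kl.1 kl.2
  rw [← hM, hH.rank_eq_card_non_zero_eigs, Fintype.card_subtype] at hrank
  have hjv := Fis.jv_pos hd kl.1 kl.2
  have hF0 : 0 ≤ F := by
    obtain ⟨x, hx⟩ := hXne
    have h0 := (Fis.psd_Mat hd X hXsphere kl.1 kl.2).eigenvalues_nonneg ⟨x, hx⟩
    exact (mul_nonneg hf.le h0).trans (heig _)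
  have hle : f kl * ∑ i, hH.eigenvalues i ≤ Fis.jv d kl.1 kl.2 * F := by
    rw [← Finset.sum_filter_ne_zero, Finset.mul_sum]
    refine (Finset.sum_le_card_nsmul _ _ F fun i _ => heig i).trans ?_
    rw [nsmul_eq_mul]
    exact mul_le_mul_of_nonneg_right hrank hF0
  rw [← htr] at hle
  refine le_of_mul_le_mul_right ?_ hjv
  linarith
end
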